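/- arXiv:1006.0122 — 2 statements merged into one kernel-verified Lean document; each statement's English description precedes it below -/
import Mathlib

section
/- Let a(x,ξ) be a symbol of class S^{m,q}, meaning a is smooth on ℝ² and for all k, β ∈ ℕ there is C_{k,β} with |∂_x^k ∂_ξ^β a(x,ξ)| ≤ C_{k,β} ⟨x⟩^{q−k} ⟨ξ⟩^{m−β}. Suppose a is real-valued. Then there exists C > 0 such that for all u in the Schwartz class, |Im ∫ (a(x,D)u)(x) \overline{u(x)} dx| ≤ C ‖⟨x⟩^{(q−1)/2} ⟨D⟩^{(m−1)/2} u‖²_{L²}. -/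
open MeasureTheory Complex ComplexConjugate

noncomputable section

/-- Japanese bracket `⟨x⟩ = (1+x²)^{1/2}`. -/
def jap (x : ℝ) : ℝ := Real.sqrt (1 + x ^ 2)

/-- Fourier transform with the convention `û(ξ) = ∫ e^{-ixξ} u(x) dx`. -/
def FT (u : ℝ → ℂ) (ξ : ℝ) : ℂ := ∫ x : ℝ, Complex.exp (-(Complex.I * (x : ℂ) * (ξ : ℂ))) * u x

/-- Inverse Fourier transform `(1/2π) ∫ e^{ixξ} v(ξ) dξ`. -/
def FTinv (v : ℝ → ℂ) (x : ℝ) : ℂ :=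
  ((2 * Real.pi)⁻¹ : ℝ) • ∫ ξ : ℝ, Complex.exp (Complex.I * (x : ℂ) * (ξ : ℂ)) * v ξ

/-- The Fourier multiplier `|D|^α` with symbol `|ξ|^α`. -/
def fracD (α : ℝ) (u : ℝ → ℂ) : ℝ → ℂ :=
  FTinv (fun ξ => ((|ξ| ^ α : ℝ) : ℂ) * FT u ξ)

end

open scoped ContDiff FourierTransform
open SchwartzMap

lemma one_le_jap (x : ℝ) : 1 ≤ jap x := by
  unfold jap
  exact Real.one_le_sqrt.2 (by nlinarith [sq_nonneg x])

lemma jap_pos (x : ℝ) : 0 < jap x := lt_of_lt_of_le one_pos (one_le_jap x)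

lemma jap_sq (x : ℝ) : jap x ^ 2 = 1 + x ^ 2 := by
  unfold jap
  exact Real.sq_sqrt (by positivity)

lemma jap_neg (x : ℝ) : jap (-x) = jap x := by simp [jap]

lemma jap_rpow_pos (x s : ℝ) : 0 < jap x ^ s := Real.rpow_pos_of_pos (jap_pos x) s

lemma jap_mono {x y : ℝ} (h : |x| ≤ |y|) : jap x ≤ jap y := by
  unfold jap
  exact Real.sqrt_le_sqrt (by nlinarith [sq_le_sq.2 h])

lemma abs_le_jap (x : ℝ) : |x| ≤ jap x :=
  Real.abs_le_sqrt (by linarith)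

lemma jap_add_le (x y : ℝ) : jap (x + y) ≤ 2 * (jap x * jap y) := by
  have h := jap_pos x
  have h' := jap_pos y
  refine le_of_sq_le_sq ?_ (by positivity)
  rw [mul_pow, mul_pow, jap_sq, jap_sq, jap_sq]
  nlinarith [sq_nonneg (x - y), sq_nonneg (x * y), sq_nonneg x, sq_nonneg y]

/-- Peetre's inequality. -/
lemma jap_rpow_le (s x y : ℝ) :
    jap x ^ s ≤ 2 ^ |s| * jap y ^ s * jap (x - y) ^ |s| := by
  have hx := jap_pos x
  have hy := jap_pos y
  have hd := jap_pos (x - y)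
  rcases le_total 0 s with hs | hs
  · rw [abs_of_nonneg hs]
    calc jap x ^ s ≤ (2 * (jap y * jap (x - y))) ^ s := by
          refine Real.rpow_le_rpow hx.le ?_ hs
          simpa using jap_add_le y (x - y)
      _ = _ := by
          rw [Real.mul_rpow (by norm_num) (by positivity), Real.mul_rpow hy.le hd.le]; ring
  · rw [abs_of_nonpos hs]
    have h1 : jap y ^ (-s) ≤ (2 * (jap x * jap (x - y))) ^ (-s) := by
      refine Real.rpow_le_rpow hy.le ?_ (by linarith)
      have := jap_add_le x (y - x)
      rw [← jap_neg (y - x)] at this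
      simpa using this
    rw [Real.mul_rpow (by norm_num) (by positivity), Real.mul_rpow hx.le hd.le,
      Real.rpow_neg hy.le, Real.rpow_neg hx.le] at h1
    have hxs := jap_rpow_pos x s
    have hys := jap_rpow_pos y s
    calc jap x ^ s = (jap x ^ s * jap y ^ s) * (jap y ^ s)⁻¹ := by field_simp
      _ ≤ (jap x ^ s * jap y ^ s) *
          (2 ^ (-s) * ((jap x ^ s)⁻¹ * jap (x - y) ^ (-s))) := by gcongr
      _ = _ := by field_simp

lemma continuous_jap : Continuous jap := by
  unfold jap
  fun_prop

lemma continuous_jap_rpow (s : ℝ) : Continuous fun x => jap x ^ s :=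
  continuous_jap.rpow_const fun x => Or.inl (jap_pos x).ne.symm

/-- Families of smooth functions all of whose derivatives are bounded by multiples of a weight,
uniformly in the parameter. -/
def UniformSymbol {ι E F : Type*} [NormedAddCommGroup E] [NormedSpace ℝ E]
    [NormedAddCommGroup F] [NormedSpace ℝ F] (w : E → ℝ) (f : ι → E → F) : Prop :=
  (∀ i, ContDiff ℝ ∞ (f i)) ∧
    ∀ n : ℕ, ∃ C, 0 ≤ C ∧ ∀ i z, ‖iteratedFDeriv ℝ n (f i) z‖ ≤ C * w z

namespace UniformSymbol

variable {ι κ E E' F F' : Type*} [NormedAddCommGroup E] [NormedSpace ℝ E]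
  [NormedAddCommGroup E'] [NormedSpace ℝ E'] [NormedAddCommGroup F] [NormedSpace ℝ F]
  [NormedAddCommGroup F'] [NormedSpace ℝ F'] {w w' : E → ℝ}

lemma bound {f : ι → E → F} (h : UniformSymbol w f) :
    ∃ C, 0 ≤ C ∧ ∀ i z, ‖f i z‖ ≤ C * w z := by
  simpa using h.2 0

lemma mono {f : ι → E → F} (h : UniformSymbol w f) {c : ℝ} (hc : 0 ≤ c)
    (hw : ∀ z, w z ≤ c * w' z) : UniformSymbol w' f := by
  refine ⟨h.1, fun n => ?_⟩
  obtain ⟨C, hC, hb⟩ := h.2 n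
  refine ⟨C * c, by positivity, fun i z => (hb i z).trans ?_⟩
  rw [mul_assoc]
  exact mul_le_mul_of_nonneg_left (hw z) hC

lemma reindex {f : ι → E → F} (h : UniformSymbol w f) (e : κ → ι) :
    UniformSymbol w fun k => f (e k) :=
  ⟨fun k => h.1 (e k), fun n => (h.2 n).imp fun _ hC => ⟨hC.1, fun k => hC.2 (e k)⟩⟩

lemma congr {f g : ι → E → F} (h : UniformSymbol w f) (hfg : ∀ i z, g i z = f i z) :
    UniformSymbol w g := by
  rwa [show g = f from funext fun i => funext (hfg i)]

lemma add {f g : ι → E → F} (hf : UniformSymbol w f) (hg : UniformSymbol w g) :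
    UniformSymbol w fun i z => f i z + g i z := by
  refine ⟨fun i => (hf.1 i).add (hg.1 i), fun n => ?_⟩
  obtain ⟨C, hC, hb⟩ := hf.2 n
  obtain ⟨C', hC', hb'⟩ := hg.2 n
  refine ⟨C + C', by positivity, fun i z => ?_⟩
  have := iteratedFDeriv_add_apply (x := z) (i := n)
    (((hf.1 i).of_le (by exact_mod_cast le_top)).contDiffAt)
    (((hg.1 i).of_le (by exact_mod_cast le_top)).contDiffAt)
  change ‖iteratedFDeriv ℝ n (f i + g i) z‖ ≤ _
  rw [this]
  calc _ ≤ _ := norm_add_le _ _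
    _ ≤ C * w z + C' * w z := add_le_add (hb i z) (hb' i z)
    _ = _ := by ring

lemma clm_comp {f : ι → E → F} (hf : UniformSymbol w f) (L : F →L[ℝ] F') :
    UniformSymbol w fun i z => L (f i z) := by
  refine ⟨fun i => L.contDiff.comp (hf.1 i), fun n => ?_⟩
  obtain ⟨C, hC, hb⟩ := hf.2 n
  refine ⟨‖L‖ * C, by positivity, fun i z => ?_⟩
  refine (L.norm_iteratedFDeriv_comp_left ((hf.1 i).contDiffAt (x := z))
    (by exact_mod_cast le_top)).trans ?_
  rw [mul_assoc]
  exact mul_le_mul_of_nonneg_left (hb i z) (norm_nonneg _)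

lemma sub {f g : ι → E → F} (hf : UniformSymbol w f) (hg : UniformSymbol w g) :
    UniformSymbol w fun i z => f i z - g i z := by
  refine (hf.add (hg.clm_comp (-(ContinuousLinearMap.id ℝ F)))).congr fun i z => ?_
  simp [sub_eq_add_neg]

lemma mul {f g : ι → E → ℂ} (hf : UniformSymbol w f) (hg : UniformSymbol w' g) :
    UniformSymbol (fun z => w z * w' z) fun i z => f i z * g i z := by
  refine ⟨fun i => (hf.1 i).mul (hg.1 i), fun n => ?_⟩
  choose C hC hb using hf.2
  choose C' hC' hb' using hg.2
  refine ⟨∑ k ∈ Finset.range (n + 1), (n.choose k : ℝ) * C k * C' (n - k),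
    Finset.sum_nonneg fun k _ => mul_nonneg (mul_nonneg (by positivity) (hC _)) (hC' _),
    fun i z => ?_⟩
  refine (norm_iteratedFDeriv_mul_le (hf.1 i) (hg.1 i) z (by exact_mod_cast le_top)).trans ?_
  rw [Finset.sum_mul]
  refine Finset.sum_le_sum fun k _ => ?_
  calc _ ≤ (n.choose k : ℝ) * (C k * w z) * (C' (n - k) * w' z) := by
        have h1 := hb k i z
        have h2 := hb' (n - k) i z
        have h3 := (norm_nonneg _).trans h1
        gcongr
    _ = _ := by ring

lemma fderiv_apply {f : ι → E → F} (hf : UniformSymbol w f) (v : E) :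
    UniformSymbol w fun i z => fderiv ℝ (f i) z v := by
  have : UniformSymbol w fun i => fderiv ℝ (f i) := by
    refine ⟨fun i => (hf.1 i).fderiv_right (by simp), fun n => ?_⟩
    simpa only [norm_iteratedFDeriv_fderiv] using hf.2 (n + 1)
  exact this.clm_comp (ContinuousLinearMap.apply ℝ F v)

lemma comp_clm {f : ι → E → F} (hf : UniformSymbol w f) (L : ι → E' →L[ℝ] E) {M : ℝ}
    (hL : ∀ i, ‖L i‖ ≤ M) {w' : E' → ℝ} (hw : ∀ i z, w (L i z) ≤ w' z) :
    UniformSymbol w' fun i z => f i (L i z) := by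
  refine ⟨fun i => (hf.1 i).comp (L i).contDiff, fun n => ?_⟩
  obtain ⟨C, hC, hb⟩ := hf.2 n
  refine ⟨C * max M 0 ^ n, by positivity, fun i z => ?_⟩
  have := (L i).iteratedFDeriv_comp_right (hf.1 i) z (i := n) (by exact_mod_cast le_top)
  change ‖iteratedFDeriv ℝ n (f i ∘ L i) z‖ ≤ _
  rw [this]
  refine (ContinuousMultilinearMap.norm_compContinuousLinearMap_le _ _).trans ?_
  rw [Finset.prod_const, Finset.card_univ, Fintype.card_fin]
  have h1 := (hb i (L i z)).trans (mul_le_mul_of_nonneg_left (hw i z) hC)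
  have h2 := (norm_nonneg _).trans h1
  calc _ ≤ (C * w' z) * max M 0 ^ n := by
        gcongr
        exact (hL i).trans (le_max_left _ _)
    _ = _ := by ring

lemma const_mul {f : ι → E → ℂ} (hf : UniformSymbol w f) (c : ℂ) :
    UniformSymbol w fun i z => c * f i z :=
  hf.clm_comp (ContinuousLinearMap.mul ℝ ℂ c)

end UniformSymbol

namespace UniformSymbol

variable {ι F : Type*} [NormedAddCommGroup F] [NormedSpace ℝ F]

/-- A smooth function solving `f' = f g` is a symbol if `g` is one of weight one. -/
lemma of_hasDerivAt_mul {w : ℝ → ℝ} {f g : ℝ → ℂ} (hf : ContDiff ℝ ∞ f)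
    (hg : UniformSymbol (fun _ => 1) fun _ : Unit => g)
    (hfg : ∀ x, HasDerivAt f (f x * g x) x) {C : ℝ} (hC : 0 ≤ C) (hb : ∀ x, ‖f x‖ ≤ C * w x) :
    UniformSymbol w fun _ : ι => f := by
  suffices h : ∀ n : ℕ, ∃ C, 0 ≤ C ∧ ∀ z, ‖iteratedFDeriv ℝ n f z‖ ≤ C * w z from
    ⟨fun _ => hf, fun n => (h n).imp fun C h => ⟨h.1, fun _ => h.2⟩⟩
  intro n
  induction n using Nat.strong_induction_on with
  | _ n ih =>
    rcases n with _ | n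
    · exact ⟨C, hC, by simpa using hb⟩
    · choose! K hK hKb using ih
      choose K' hK' hKb' using hg.2
      refine ⟨∑ k ∈ Finset.range (n + 1), (n.choose k : ℝ) * K k * K' (n - k),
        Finset.sum_nonneg fun k hk => mul_nonneg (mul_nonneg (by positivity)
          (hK _ (by simpa using hk))) (hK' _), fun z => ?_⟩
      rw [norm_iteratedFDeriv_eq_norm_iteratedDeriv, iteratedDeriv_succ',
        show deriv f = fun x => f x * g x from funext fun x => (hfg x).deriv,
        ← norm_iteratedFDeriv_eq_norm_iteratedDeriv]
      refine (norm_iteratedFDeriv_mul_le hf (hg.1 ()) z (by exact_mod_cast le_top)).trans ?_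
      rw [Finset.sum_mul]
      refine Finset.sum_le_sum fun k hk => ?_
      have h1 := hKb k (by simpa using hk) z
      have h2 := hKb' (n - k) () z
      have h3 := (norm_nonneg _).trans h1
      calc _ ≤ (n.choose k : ℝ) * (K k * w z) * (K' (n - k) * 1) := by gcongr
        _ = _ := by ring

/-- Functions on the plane with all mixed partial derivatives bounded by a weight. -/
lemma of_partial_derivatives {w : ℝ × ℝ → ℝ} (f : ℕ → ℕ → ℝ × ℝ → F)
    (hf : ∀ k l, ContDiff ℝ ∞ (f k l))
    (h1 : ∀ k l z, fderiv ℝ (f k l) z (1, 0) = f (k + 1) l z)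
    (h2 : ∀ k l z, fderiv ℝ (f k l) z (0, 1) = f k (l + 1) z)
    (hb : ∀ k l, ∃ C, 0 ≤ C ∧ ∀ z, ‖f k l z‖ ≤ C * w z) :
    UniformSymbol w fun _ : ι => f 0 0 := by
  suffices h : ∀ n k l : ℕ, ∃ C, 0 ≤ C ∧ ∀ z, ‖iteratedFDeriv ℝ n (f k l) z‖ ≤ C * w z from
    ⟨fun _ => hf 0 0, fun n => (h n 0 0).imp fun C h => ⟨h.1, fun _ => h.2⟩⟩
  intro n
  induction n with
  | zero => simpa using hb
  | succ n ih =>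
    intro k l
    obtain ⟨C, hC, hCb⟩ := ih (k + 1) l
    obtain ⟨C', hC', hCb'⟩ := ih k (l + 1)
    let P : F →L[ℝ] (ℝ × ℝ →L[ℝ] F) :=
      ContinuousLinearMap.smulRightL ℝ (ℝ × ℝ) F (ContinuousLinearMap.fst ℝ ℝ ℝ)
    let Q : F →L[ℝ] (ℝ × ℝ →L[ℝ] F) :=
      ContinuousLinearMap.smulRightL ℝ (ℝ × ℝ) F (ContinuousLinearMap.snd ℝ ℝ ℝ)
    have key : fderiv ℝ (f k l) = P ∘ f (k + 1) l + Q ∘ f k (l + 1) := by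
      ext z
      · simp [P, Q, ← h1, ← h2]
      · simp [P, Q, ← h1, ← h2]
    refine ⟨‖P‖ * C + ‖Q‖ * C', by positivity, fun z => ?_⟩
    rw [← norm_iteratedFDeriv_fderiv, key, iteratedFDeriv_add_apply
      ((P.contDiff.comp (hf _ _)).of_le (by exact_mod_cast le_top)).contDiffAt
      ((Q.contDiff.comp (hf _ _)).of_le (by exact_mod_cast le_top)).contDiffAt]
    have e1 := P.norm_iteratedFDeriv_comp_left ((hf (k + 1) l).contDiffAt (x := z)) (n := n)
      (by exact_mod_cast le_top)
    have e2 := Q.norm_iteratedFDeriv_comp_left ((hf k (l + 1)).contDiffAt (x := z)) (n := n)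
      (by exact_mod_cast le_top)
    calc _ ≤ _ := norm_add_le _ _
      _ ≤ ‖P‖ * (C * w z) + ‖Q‖ * (C' * w z) := by
        refine add_le_add (e1.trans ?_) (e2.trans ?_)
        · exact mul_le_mul_of_nonneg_left (hCb z) (norm_nonneg _)
        · exact mul_le_mul_of_nonneg_left (hCb' z) (norm_nonneg _)
      _ = _ := by ring

end UniformSymbol

/-- The resolvent symbol `(1 + i x)⁻¹`. -/
noncomputable def res (x : ℝ) : ℂ := (1 + I * x)⁻¹

lemma one_add_I_mul_ne_zero (x : ℝ) : (1 + I * x : ℂ) ≠ 0 := by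
  intro h
  simpa using congrArg Complex.re h

lemma norm_one_add_I_mul (x : ℝ) : ‖(1 + I * x : ℂ)‖ = jap x := by
  rw [Complex.norm_def, jap, Complex.normSq_apply]
  simp
  ring_nf

lemma norm_res (x : ℝ) : ‖res x‖ = (jap x)⁻¹ := by
  rw [res, norm_inv, norm_one_add_I_mul]

lemma hasDerivAt_res (x : ℝ) : HasDerivAt res (-I * res x ^ 2) x := by
  have h : HasDerivAt (fun x : ℝ => (1 + I * x : ℂ)) I x := by
    simpa using ((hasDerivAt_id x).ofReal_comp.const_mul I).const_add 1
  refine HasDerivAt.congr_deriv (f := res) (h.inv (one_add_I_mul_ne_zero x)) ?_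
  simp [res, div_eq_mul_inv]

lemma contDiff_res : ContDiff ℝ ∞ res := by
  unfold res
  refine ContDiff.inv ?_ one_add_I_mul_ne_zero
  exact contDiff_const.add (contDiff_const.mul Complex.ofRealCLM.contDiff)

lemma iteratedDeriv_res (n : ℕ) :
    iteratedDeriv n res = fun x => (-I) ^ n * n.factorial * res x ^ (n + 1) := by
  induction n with
  | zero => ext; simp
  | succ n ih =>
    rw [iteratedDeriv_succ, ih]
    ext x
    refine (((hasDerivAt_res x).pow (n + 1)).const_mul _).deriv.trans ?_
    simp only [Nat.factorial_succ]
    push_cast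
    ring

lemma uniformSymbol_res {ι : Type*} : UniformSymbol (fun x => (jap x)⁻¹) fun _ : ι => res := by
  refine ⟨fun _ => contDiff_res, fun n => ⟨n.factorial, by positivity, fun _ x => ?_⟩⟩
  rw [norm_iteratedFDeriv_eq_norm_iteratedDeriv, iteratedDeriv_res]
  simp only [norm_mul, norm_pow, norm_neg, norm_I, one_pow, one_mul, norm_natCast, norm_res]
  rw [pow_succ]
  have : ((jap x)⁻¹) ^ n ≤ 1 := pow_le_one₀ (inv_nonneg.2 (jap_pos x).le)
    (inv_le_one_of_one_le₀ (one_le_jap x))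
  have h2 := inv_nonneg.2 (jap_pos x).le
  gcongr
  exact mul_le_of_le_one_left h2 this

/-- The logarithmic derivative `x / (1 + x²)` of the Japanese bracket. -/
noncomputable def logDerivJap (x : ℝ) : ℂ := ((x / (1 + x ^ 2) : ℝ) : ℂ)

lemma uniformSymbol_logDerivJap {ι : Type*} :
    UniformSymbol (fun x => (jap x)⁻¹) fun _ : ι => logDerivJap := by
  refine (uniformSymbol_res.clm_comp (-(Complex.ofRealCLM.comp Complex.imCLM))).congr
    fun _ x => ?_
  simp only [logDerivJap, res, neg_apply, ContinuousLinearMap.comp_apply,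
    Complex.imCLM_apply, Complex.ofRealCLM_apply, Complex.inv_im, Complex.normSq_apply]
  rw [← Complex.ofReal_neg]
  congr 1
  simp
  ring

lemma hasDerivAt_jap_rpow (s x : ℝ) :
    HasDerivAt (fun x => ((jap x ^ s : ℝ) : ℂ))
      (((jap x ^ s : ℝ) : ℂ) * (s * logDerivJap x)) x := by
  have h1 : HasDerivAt jap (x / jap x) x := by
    have h : HasDerivAt (fun x : ℝ => 1 + x ^ 2) (2 * x) x := by
      simpa using ((hasDerivAt_pow 2 x)).const_add 1
    convert h.sqrt (by positivity) using 1
    · rfl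
    change x / √(1 + x ^ 2) = _
    field_simp
  have h2 := (h1.rpow_const (p := s) (Or.inl (jap_pos x).ne')).ofReal_comp
  convert h2 using 1
  rw [logDerivJap]
  norm_cast
  rw [Real.rpow_sub (jap_pos x), ← jap_sq, Real.rpow_one]
  have := jap_pos x
  field_simp

lemma contDiff_jap_rpow (s : ℝ) : ContDiff ℝ ∞ fun x => ((jap x ^ s : ℝ) : ℂ) := by
  refine Complex.ofRealCLM.contDiff.comp ?_
  refine ContDiff.rpow_const_of_ne ?_ fun x => (jap_pos x).ne'
  unfold jap
  exact ContDiff.sqrt (by fun_prop) fun x => by positivity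

lemma norm_jap_rpow (s x : ℝ) : ‖((jap x ^ s : ℝ) : ℂ)‖ = jap x ^ s := by
  rw [Complex.norm_real, Real.norm_of_nonneg (jap_rpow_pos x s).le]

lemma uniformSymbol_jap_rpow {ι : Type*} (s : ℝ) :
    UniformSymbol (fun x => jap x ^ s) fun (_ : ι) x => ((jap x ^ s : ℝ) : ℂ) := by
  refine UniformSymbol.of_hasDerivAt_mul (C := 1) (contDiff_jap_rpow s) ?_
    (hasDerivAt_jap_rpow s) zero_le_one fun x => by rw [norm_jap_rpow, one_mul]
  refine (uniformSymbol_logDerivJap.const_mul (s : ℂ)).mono (c := 1) zero_le_one fun x => ?_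
  simpa using inv_le_one_of_one_le₀ (one_le_jap x)

section DirectionalDerivative

variable {E F : Type*} [NormedAddCommGroup E] [NormedSpace ℝ E]
  [NormedAddCommGroup F] [NormedSpace ℝ F]

/-- The derivative of `f` in the direction `v`. -/
noncomputable def dirDeriv (v : E) (f : E → F) : E → F := fun z => fderiv ℝ f z v

lemma ContDiff.dirDeriv {f : E → F} (hf : ContDiff ℝ ∞ f) (v : E) :
    ContDiff ℝ ∞ (dirDeriv v f) :=
  (hf.fderiv_right (by simp)).clm_apply contDiff_const

lemma ContDiff.iterate_dirDeriv {f : E → F} (hf : ContDiff ℝ ∞ f) (v : E) (n : ℕ) :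
    ContDiff ℝ ∞ ((_root_.dirDeriv v)^[n] f) := by
  induction n with
  | zero => simpa
  | succ n ih =>
    rw [Function.iterate_succ_apply']
    exact ih.dirDeriv v

lemma dirDeriv_comm {f : E → F} (hf : ContDiff ℝ ∞ f) (v w : E) :
    dirDeriv v (dirDeriv w f) = dirDeriv w (dirDeriv v f) := by
  have hd : Differentiable ℝ (fderiv ℝ f) :=
    (hf.fderiv_right (m := ∞) (by simp)).differentiable (by simp)
  have key : ∀ (v w z : E), dirDeriv v (dirDeriv w f) z = fderiv ℝ (fderiv ℝ f) z v w := by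
    intro v w z
    have := ((hd z).hasFDerivAt.clm_apply (hasFDerivAt_const w z)).fderiv
    unfold dirDeriv
    rw [this]
    simp
  ext z
  rw [key, key]
  exact ((contDiff_infty.1 hf 2).contDiffAt.isSymmSndFDerivAt (by simp)) v w

lemma dirDeriv_iterate_comm {f : E → F} (hf : ContDiff ℝ ∞ f) (v w : E) (n : ℕ) :
    dirDeriv w ((dirDeriv v)^[n] f) = (dirDeriv v)^[n] (dirDeriv w f) := by
  induction n with
  | zero => rfl
  | succ n ih =>
    rw [Function.iterate_succ_apply', Function.iterate_succ_apply', ← ih,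
      dirDeriv_comm (hf.iterate_dirDeriv v n)]

end DirectionalDerivative

lemma hasDerivAt_fst {E F : Type*} [NormedAddCommGroup E] [NormedSpace ℝ E]
    [NormedAddCommGroup F] [NormedSpace ℝ F] {f : ℝ × E → F}
    (hf : ContDiff ℝ ∞ f) (x : ℝ) (ξ : E) :
    HasDerivAt (fun x => f (x, ξ)) (dirDeriv (1, 0) f (x, ξ)) x :=
  ((hf.differentiable (by simp)) (x, ξ)).hasFDerivAt.comp_hasDerivAt x
    ((hasDerivAt_id x).prodMk (hasDerivAt_const x ξ))

lemma hasDerivAt_snd {F : Type*} [NormedAddCommGroup F] [NormedSpace ℝ F] {f : ℝ × ℝ → F}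
    (hf : ContDiff ℝ ∞ f) (x ξ : ℝ) :
    HasDerivAt (fun ξ => f (x, ξ)) (dirDeriv (0, 1) f (x, ξ)) ξ :=
  ((hf.differentiable (by simp)) (x, ξ)).hasFDerivAt.comp_hasDerivAt ξ
    ((hasDerivAt_const ξ x).prodMk (hasDerivAt_id ξ))

lemma iteratedDeriv_fst {f : ℝ × ℝ → ℝ} (hf : ContDiff ℝ ∞ f) (n : ℕ) (ξ : ℝ) :
    iteratedDeriv n (fun x => f (x, ξ)) = fun x => (dirDeriv (1, 0))^[n] f (x, ξ) := by
  induction n with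
  | zero => ext; simp
  | succ n ih =>
    rw [iteratedDeriv_succ, ih, Function.iterate_succ_apply']
    exact funext fun x => (hasDerivAt_fst (hf.iterate_dirDeriv _ n) x ξ).deriv

lemma iteratedDeriv_snd {f : ℝ × ℝ → ℝ} (hf : ContDiff ℝ ∞ f) (n : ℕ) (x : ℝ) :
    iteratedDeriv n (fun ξ => f (x, ξ)) = fun ξ => (dirDeriv (0, 1))^[n] f (x, ξ) := by
  induction n with
  | zero => ext; simp
  | succ n ih =>
    rw [iteratedDeriv_succ, ih, Function.iterate_succ_apply']
    exact funext fun ξ => (hasDerivAt_snd (hf.iterate_dirDeriv _ n) x ξ).deriv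

/-- The derivatives `∂_ξ a` and `∂_x ∂_ξ a` of a symbol of class `S^{m,q}`. -/
lemma exists_symbol_derivatives {ι : Type*} {m q : ℝ} {a : ℝ → ℝ → ℝ}
    (ha_smooth : ContDiff ℝ (⊤ : ℕ∞) (fun p : ℝ × ℝ => a p.1 p.2))
    (ha : ∀ k β : ℕ, ∃ C : ℝ, 0 < C ∧ ∀ x ξ : ℝ,
      |iteratedDeriv k (fun x' : ℝ => iteratedDeriv β (fun ξ' : ℝ => a x' ξ') ξ) x|
        ≤ C * jap x ^ (q - (k : ℝ)) * jap ξ ^ (m - (β : ℝ))) :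
    ∃ b c : ℝ × ℝ → ℂ,
      UniformSymbol (fun z => jap z.1 ^ q * jap z.2 ^ (m - 1)) (fun _ : ι => b) ∧
      UniformSymbol (fun z => jap z.1 ^ (q - 1) * jap z.2 ^ (m - 1)) (fun _ : ι => c) ∧
      (∀ x ξ, HasDerivAt (fun ξ => (a x ξ : ℂ)) (b (x, ξ)) ξ) ∧
      ∀ x ξ, HasDerivAt (fun x => b (x, ξ)) (c (x, ξ)) x := by
  set A : ℝ × ℝ → ℝ := fun p => a p.1 p.2 with hA
  have hA' : ContDiff ℝ ∞ A := ha_smooth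
  have hs : ∀ k l, ContDiff ℝ ∞ ((dirDeriv (1, 0))^[k] ((dirDeriv (0, 1))^[l] A)) := fun k l =>
    (hA'.iterate_dirDeriv _ _).iterate_dirDeriv _ _
  have hb : ∀ k l : ℕ, ∃ C, 0 < C ∧ ∀ z : ℝ × ℝ,
      ‖(dirDeriv (1, 0))^[k] ((dirDeriv (0, 1))^[l] A) z‖ ≤
        C * (jap z.1 ^ (q - (k : ℝ)) * jap z.2 ^ (m - (l : ℝ))) := by
    intro k l
    obtain ⟨C, hC, h⟩ := ha k l
    refine ⟨C, hC, fun z => ?_⟩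
    have h1 : ∀ x' : ℝ, iteratedDeriv l (fun ξ' => a x' ξ') z.2 =
        (dirDeriv (0, 1))^[l] A (x', z.2) := fun x' =>
      congrFun (iteratedDeriv_snd hA' l x') z.2
    have h2 := h z.1 z.2
    simp only [h1] at h2
    rw [iteratedDeriv_fst (hA'.iterate_dirDeriv _ l)] at h2
    rw [← mul_assoc]
    exact h2
  have hd1 : ∀ k l z, fderiv ℝ ((dirDeriv (1, 0))^[k] ((dirDeriv (0, 1))^[l] A)) z (1, 0) =
      (dirDeriv (1, 0))^[k + 1] ((dirDeriv (0, 1))^[l] A) z := by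
    intro k l z
    rw [Function.iterate_succ_apply']
    rfl
  have hd2 : ∀ k l z, fderiv ℝ ((dirDeriv (1, 0))^[k] ((dirDeriv (0, 1))^[l] A)) z (0, 1) =
      (dirDeriv (1, 0))^[k] ((dirDeriv (0, 1))^[l + 1] A) z := by
    intro k l z
    rw [Function.iterate_succ_apply' (dirDeriv (0, 1)),
      ← dirDeriv_iterate_comm (hA'.iterate_dirDeriv _ l)]
    rfl
  have hle : ∀ (x s t : ℝ), s ≤ t → jap x ^ s ≤ jap x ^ t := fun x s t h =>
    Real.rpow_le_rpow_of_exponent_le (one_le_jap x) h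
  have H : ∀ k₀ : ℕ, UniformSymbol (fun z => jap z.1 ^ (q - (k₀ : ℝ)) * jap z.2 ^ (m - 1))
      fun _ : ι => (dirDeriv (1, 0))^[k₀] ((dirDeriv (0, 1))^[1] A) := by
    intro k₀
    have := UniformSymbol.of_partial_derivatives (ι := ι)
      (w := fun z => jap z.1 ^ (q - (k₀ : ℝ)) * jap z.2 ^ (m - 1))
      (fun k l => (dirDeriv (1, 0))^[k₀ + k] ((dirDeriv (0, 1))^[1 + l] A))
      (fun k l => hs _ _) (fun k l => hd1 _ _) (fun k l => hd2 _ _) fun k l => by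
        obtain ⟨C, hC, h⟩ := hb (k₀ + k) (1 + l)
        refine ⟨C, hC.le, fun z => (h z).trans ?_⟩
        have e1 := hle z.1 (q - ((k₀ + k : ℕ) : ℝ)) (q - (k₀ : ℝ)) (by push_cast; linarith)
        have e2 := hle z.2 (m - ((1 + l : ℕ) : ℝ)) (m - 1) (by push_cast; linarith)
        have := jap_rpow_pos z.1 (q - (k₀ : ℝ))
        have := jap_rpow_pos z.2 (m - ((1 + l : ℕ) : ℝ))
        gcongr
    simpa using this
  refine ⟨fun z => (dirDeriv (0, 1) A z : ℝ), fun z => (dirDeriv (1, 0) (dirDeriv (0, 1) A) z : ℝ),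
    ?_, ?_, ?_, ?_⟩
  · have := (H 0).clm_comp Complex.ofRealCLM
    simpa using this
  · have := (H 1).clm_comp Complex.ofRealCLM
    simpa using this
  · exact fun x ξ => (hasDerivAt_snd hA' x ξ).ofReal_comp
  · exact fun x ξ => (hasDerivAt_fst (hA'.dirDeriv _) x ξ).ofReal_comp

namespace UniformSymbol

variable {ι E E' F : Type*} [NormedAddCommGroup E] [NormedSpace ℝ E]
  [NormedAddCommGroup E'] [NormedSpace ℝ E'] [NormedAddCommGroup F] [NormedSpace ℝ F]

lemma smul_comp_clm {w : E → ℝ} {f : ι → E → F} (hf : UniformSymbol w f) (c : ι → ℝ)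
    (L : ι → E' →L[ℝ] E) {M : ℝ} (hL : ∀ i, ‖L i‖ ≤ M) {w' : E' → ℝ}
    (hw : ∀ i z, |c i| * w (L i z) ≤ w' z) :
    UniformSymbol w' fun i z => c i • f i (L i z) := by
  refine ⟨fun i => contDiff_const.smul ((hf.1 i).comp (L i).contDiff), fun n => ?_⟩
  obtain ⟨C, hC, hb⟩ := hf.2 n
  refine ⟨C * max M 0 ^ n, by positivity, fun i z => ?_⟩
  have := (L i).iteratedFDeriv_comp_right (hf.1 i) z (i := n) (by exact_mod_cast le_top)
  change ‖iteratedFDeriv ℝ n (c i • (f i ∘ L i)) z‖ ≤ _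
  rw [iteratedFDeriv_const_smul_apply
    ((contDiff_infty.1 ((hf.1 i).comp (L i).contDiff) n).contDiffAt), this, norm_smul,
    Real.norm_eq_abs]
  have h0 := ContinuousMultilinearMap.norm_compContinuousLinearMap_le
    (iteratedFDeriv ℝ n (f i) (L i z)) fun _ => L i
  rw [Finset.prod_const, Finset.card_univ, Fintype.card_fin] at h0
  have h1 := hb i (L i z)
  have h2 := (norm_nonneg _).trans h1
  calc _ ≤ |c i| * ((C * w (L i z)) * max M 0 ^ n) := by
        refine mul_le_mul_of_nonneg_left (h0.trans ?_) (abs_nonneg _)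
        gcongr
        exact (hL i).trans (le_max_left _ _)
    _ = (C * (|c i| * w (L i z))) * max M 0 ^ n := by ring
    _ ≤ (C * w' z) * max M 0 ^ n := by
        have := hw i z
        gcongr
    _ = _ := by ring

lemma hasTemperateGrowth {f : ι → ℝ → ℂ} {s : ℝ} (hf : UniformSymbol (fun x => jap x ^ s) f)
    (i : ι) : (f i).HasTemperateGrowth := by
  refine ⟨hf.1 i, fun n => ?_⟩
  obtain ⟨C, hC, hb⟩ := hf.2 n
  refine ⟨⌈s⌉₊, C, fun x => (hb i x).trans ?_⟩
  refine mul_le_mul_of_nonneg_left ?_ hC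
  calc jap x ^ s ≤ jap x ^ (⌈s⌉₊ : ℝ) :=
        Real.rpow_le_rpow_of_exponent_le (one_le_jap x) (Nat.le_ceil s)
    _ = jap x ^ ⌈s⌉₊ := Real.rpow_natCast _ _
    _ ≤ _ := by
        have := (jap_pos x).le
        gcongr
        refine le_of_sq_le_sq ?_ (by positivity)
        rw [jap_sq, Real.norm_eq_abs, ← sq_abs]
        nlinarith [abs_nonneg x]

end UniformSymbol

section Regularization

/-- The regularizing factor `⟨ε x⟩^{-σ}`. -/
noncomputable def damp (σ ε x : ℝ) : ℂ := ((jap (ε * x) ^ (-σ) : ℝ) : ℂ)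

/-- The derivative of the regularizing factor. -/
noncomputable def dampDeriv (σ ε x : ℝ) : ℂ :=
  ε • (((jap (ε * x) ^ (-σ) : ℝ) : ℂ) * (((-σ : ℝ) : ℂ) * logDerivJap (ε * x)))

lemma hasDerivAt_damp (σ ε x : ℝ) : HasDerivAt (damp σ ε) (dampDeriv σ ε x) x := by
  have h : HasDerivAt (fun x => ε * x) ε x := by
    simpa using (hasDerivAt_id x).const_mul ε
  exact (hasDerivAt_jap_rpow (-σ) (ε * x)).scomp x h

lemma norm_damp_le_one {σ : ℝ} (hσ : 0 ≤ σ) (ε x : ℝ) : ‖damp σ ε x‖ ≤ 1 := by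
  rw [damp, norm_jap_rpow]
  exact Real.rpow_le_one_of_one_le_of_nonpos (one_le_jap _) (by linarith)

lemma mul_jap_le {ε : ℝ} (hε : ε ∈ Set.Ioc (0 : ℝ) 1) (x : ℝ) : ε * jap x ≤ jap (ε * x) := by
  refine le_of_sq_le_sq ?_ (jap_pos _).le
  rw [mul_pow, jap_sq, jap_sq]
  nlinarith [mul_le_one₀ hε.2 hε.1.le hε.2]

/-- Multiplication by a scalar as a continuous linear map of the line. -/
noncomputable def scaleCLM (ε : ℝ) : ℝ →L[ℝ] ℝ := ε • ContinuousLinearMap.id ℝ ℝ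

lemma norm_scaleCLM_le {ε : ℝ} (hε : ε ∈ Set.Ioc (0 : ℝ) 1) : ‖scaleCLM ε‖ ≤ 1 := by
  rw [scaleCLM, norm_smul, ContinuousLinearMap.norm_id, mul_one, Real.norm_eq_abs,
    abs_of_pos hε.1]
  exact hε.2

lemma uniformSymbol_damp {σ : ℝ} (hσ : 0 ≤ σ) :
    UniformSymbol (fun _ => 1) fun ε : Set.Ioc (0 : ℝ) 1 => damp σ ε := by
  refine (uniformSymbol_jap_rpow (-σ)).comp_clm (fun ε : Set.Ioc (0 : ℝ) 1 => scaleCLM ε)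
    (fun ε => norm_scaleCLM_le ε.2) fun ε x => ?_
  exact Real.rpow_le_one_of_one_le_of_nonpos (one_le_jap _) (by linarith)

lemma uniformSymbol_jap_rpow_deriv {ι : Type*} (σ : ℝ) :
    UniformSymbol (fun x => jap x ^ (-σ) * (jap x)⁻¹) fun (_ : ι) x =>
      ((jap x ^ (-σ) : ℝ) : ℂ) * (((-σ : ℝ) : ℂ) * logDerivJap x) :=
  (uniformSymbol_jap_rpow (-σ)).mul (uniformSymbol_logDerivJap.const_mul _)

lemma uniformSymbol_dampDeriv {σ : ℝ} (hσ : 0 ≤ σ) :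
    UniformSymbol (fun x => (jap x)⁻¹) fun ε : Set.Ioc (0 : ℝ) 1 => dampDeriv σ ε := by
  refine (uniformSymbol_jap_rpow_deriv σ).smul_comp_clm
    (fun ε : Set.Ioc (0 : ℝ) 1 => (ε : ℝ)) (fun ε => scaleCLM ε)
    (fun ε => norm_scaleCLM_le ε.2) fun ε x => ?_
  change |(ε : ℝ)| * (jap (ε * x) ^ (-σ) * (jap (ε * x))⁻¹) ≤ (jap x)⁻¹
  have h1 : jap (ε * x) ^ (-σ) ≤ 1 :=
    Real.rpow_le_one_of_one_le_of_nonpos (one_le_jap _) (by linarith)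
  have h2 := mul_jap_le ε.2 x
  have h3 := jap_pos (ε * x)
  have h4 := jap_pos x
  have h5 := ε.2.1
  rw [abs_of_pos h5]
  calc _ ≤ (ε : ℝ) * (1 * (jap (ε * x))⁻¹) := by gcongr
    _ ≤ (jap x)⁻¹ := by
      rw [one_mul, ← div_eq_mul_inv, div_le_iff₀ h3, inv_mul_eq_div, le_div_iff₀ h4]
      exact h2

lemma jap_mul_rpow_neg_le {σ : ℝ} (hσ : 0 ≤ σ) {ε : ℝ} (hε : ε ∈ Set.Ioc (0 : ℝ) 1) (x : ℝ) :
    jap (ε * x) ^ (-σ) ≤ ε ^ (-σ) * jap x ^ (-σ) := by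
  rw [← Real.mul_rpow hε.1.le (jap_pos x).le]
  exact Real.rpow_le_rpow_of_nonpos (mul_pos hε.1 (jap_pos x)) (mul_jap_le hε x) (by linarith)

lemma uniformSymbol_damp_decay {ι : Type*} {σ : ℝ} (hσ : 0 ≤ σ) {ε : ℝ}
    (hε : ε ∈ Set.Ioc (0 : ℝ) 1) :
    UniformSymbol (fun x => jap x ^ (-σ)) fun _ : ι => damp σ ε := by
  refine ((uniformSymbol_jap_rpow (-σ)).comp_clm (fun _ : ι => scaleCLM ε)
    (fun _ => norm_scaleCLM_le hε) fun _ x => ?_).mono (Real.rpow_nonneg hε.1.le (-σ))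
      fun x => le_rfl
  exact jap_mul_rpow_neg_le hσ hε x

lemma uniformSymbol_dampDeriv_decay {ι : Type*} {σ : ℝ} (hσ : 0 ≤ σ) {ε : ℝ}
    (hε : ε ∈ Set.Ioc (0 : ℝ) 1) :
    UniformSymbol (fun x => jap x ^ (-σ)) fun _ : ι => dampDeriv σ ε := by
  refine ((uniformSymbol_jap_rpow_deriv σ).smul_comp_clm (fun _ : ι => ε) (fun _ => scaleCLM ε)
    (fun _ => norm_scaleCLM_le hε) fun _ x => ?_).mono (Real.rpow_nonneg hε.1.le (-σ))
      fun x => le_rfl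
  change |ε| * (jap (ε * x) ^ (-σ) * (jap (ε * x))⁻¹) ≤ _
  refine le_trans ?_ (jap_mul_rpow_neg_le hσ hε x)
  rw [abs_of_pos hε.1]
  have h1 := inv_le_one_of_one_le₀ (one_le_jap (ε * x))
  have h2 := jap_rpow_pos (ε * x) (-σ)
  have h3 := inv_nonneg.2 (jap_pos (ε * x)).le
  calc _ ≤ 1 * (jap (ε * x) ^ (-σ) * 1) := by
        gcongr
        exact hε.2
    _ = _ := by ring

end Regularization

section Amplitude

/-- The weight `⟨x⟩^p ⟨ξ-η⟩^d` on triples `(x, ξ, η)`. -/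
noncomputable def ampWeight (p d : ℝ) (z : ℝ × ℝ × ℝ) : ℝ := jap z.1 ^ p * jap (z.2.1 - z.2.2) ^ d

lemma ampWeight_nonneg (p d : ℝ) (z : ℝ × ℝ × ℝ) : 0 ≤ ampWeight p d z :=
  mul_nonneg (jap_rpow_pos _ _).le (jap_rpow_pos _ _).le

lemma ampWeight_mul (p d p' d' : ℝ) (z : ℝ × ℝ × ℝ) :
    ampWeight p d z * ampWeight p' d' z = ampWeight (p + p') (d + d') z := by
  simp only [ampWeight, Real.rpow_add (jap_pos _)]
  ring

lemma ampWeight_mono {p p' d d' : ℝ} (hp : p ≤ p') (hd : d ≤ d') (z : ℝ × ℝ × ℝ) :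
    ampWeight p d z ≤ ampWeight p' d' z :=
  mul_le_mul (Real.rpow_le_rpow_of_exponent_le (one_le_jap _) hp)
    (Real.rpow_le_rpow_of_exponent_le (one_le_jap _) hd) (jap_rpow_pos _ _).le
    (jap_rpow_pos _ _).le

/-- The map `(x, ξ, η) ↦ (x, η + t (ξ - η))`. -/
noncomputable def segCLM (t : ℝ) : ℝ × ℝ × ℝ →L[ℝ] ℝ × ℝ :=
  (ContinuousLinearMap.fst ℝ ℝ (ℝ × ℝ)).prod
    ((ContinuousLinearMap.snd ℝ ℝ ℝ + t • (ContinuousLinearMap.fst ℝ ℝ ℝ -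
      ContinuousLinearMap.snd ℝ ℝ ℝ)).comp (ContinuousLinearMap.snd ℝ ℝ (ℝ × ℝ)))

lemma segCLM_apply (t : ℝ) (z : ℝ × ℝ × ℝ) :
    segCLM t z = (z.1, z.2.2 + t * (z.2.1 - z.2.2)) := by
  simp [segCLM]

lemma norm_segCLM_le {t : ℝ} (ht : t ∈ Set.Icc (0 : ℝ) 1) : ‖segCLM t‖ ≤ 3 := by
  refine ContinuousLinearMap.opNorm_le_bound _ (by norm_num) fun z => ?_
  rw [segCLM_apply]
  have h1 : |z.1| ≤ ‖z‖ := norm_fst_le z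
  have h2 : |z.2.1| ≤ ‖z‖ := (norm_fst_le z.2).trans (norm_snd_le z)
  have h3 : |z.2.2| ≤ ‖z‖ := (norm_snd_le z.2).trans (norm_snd_le z)
  have h0 := norm_nonneg z
  refine norm_prod_le_iff.2 ⟨?_, ?_⟩
  · change |z.1| ≤ _
    linarith
  · change |z.2.2 + t * (z.2.1 - z.2.2)| ≤ _
    have h4 : |z.2.1 - z.2.2| ≤ 2 * ‖z‖ := (abs_sub _ _).trans (by linarith)
    calc _ ≤ |z.2.2| + |t * (z.2.1 - z.2.2)| := abs_add_le _ _
      _ ≤ ‖z‖ + 1 * (2 * ‖z‖) := by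
        rw [abs_mul, abs_of_nonneg ht.1]
        exact add_le_add h3 (mul_le_mul ht.2 h4 (abs_nonneg _) zero_le_one)
      _ = _ := by ring

/-- The projection `(x, ξ, η) ↦ ξ - η`. -/
noncomputable def freqDiffCLM : ℝ × ℝ × ℝ →L[ℝ] ℝ :=
  (ContinuousLinearMap.fst ℝ ℝ ℝ - ContinuousLinearMap.snd ℝ ℝ ℝ).comp
    (ContinuousLinearMap.snd ℝ ℝ (ℝ × ℝ))

lemma freqDiffCLM_apply (z : ℝ × ℝ × ℝ) : freqDiffCLM z = z.2.1 - z.2.2 := by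
  simp [freqDiffCLM]

lemma uniformSymbol_res_freqDiff {ι : Type*} :
    UniformSymbol (ampWeight 0 (-1)) fun (_ : ι) z => res (z.2.1 - z.2.2) := by
  refine ((uniformSymbol_res (ι := ι)).comp_clm (fun _ => freqDiffCLM) (fun _ => le_rfl)
    fun _ z => ?_).congr fun _ z => by rw [freqDiffCLM_apply]
  rw [freqDiffCLM_apply, ampWeight, Real.rpow_zero, one_mul, Real.rpow_neg_one]

lemma uniformSymbol_comp_segCLM {p s : ℝ} {f : ℝ × ℝ → ℂ}
    (hf : UniformSymbol (fun z => jap z.1 ^ p * jap z.2 ^ (2 * s)) fun _ : Unit => f) :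
    UniformSymbol (ampWeight p (3 * |s|)) fun (t : Set.Icc (0 : ℝ) 1) z =>
      f (z.1, z.2.2 + t * (z.2.1 - z.2.2)) *
        (((jap z.2.1 ^ (-s) : ℝ) : ℂ) * ((jap z.2.2 ^ (-s) : ℝ) : ℂ)) := by
  have h1 := (hf.reindex fun _ : Set.Icc (0 : ℝ) 1 => ()).comp_clm
    (fun t : Set.Icc (0 : ℝ) 1 => segCLM t) (fun t => norm_segCLM_le t.2)
    (w' := fun z => 2 ^ |2 * s| * (jap z.1 ^ p * jap z.2.1 ^ (2 * s) *
      jap (z.2.1 - z.2.2) ^ |2 * s|)) fun t z => by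
        rw [segCLM_apply]
        have h := jap_rpow_le (2 * s) (z.2.2 + t * (z.2.1 - z.2.2)) z.2.1
        have h' : jap (z.2.2 + t * (z.2.1 - z.2.2) - z.2.1) ^ |2 * s| ≤
            jap (z.2.1 - z.2.2) ^ |2 * s| := by
          refine Real.rpow_le_rpow (jap_pos _).le (jap_mono ?_) (abs_nonneg _)
          rw [show z.2.2 + t * (z.2.1 - z.2.2) - z.2.1 = (t - 1) * (z.2.1 - z.2.2) by ring, abs_mul]
          refine mul_le_of_le_one_left (abs_nonneg _) (abs_le.2 ⟨?_, ?_⟩)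
          · linarith [t.2.1]
          · linarith [t.2.2]
        have h1 := jap_rpow_pos z.1 p
        have h2 := jap_rpow_pos z.2.1 (2 * s)
        calc _ ≤ jap z.1 ^ p * (2 ^ |2 * s| * jap z.2.1 ^ (2 * s) *
              jap (z.2.1 - z.2.2) ^ |2 * s|) := by
              refine mul_le_mul_of_nonneg_left (h.trans ?_) h1.le
              gcongr
          _ = _ := by ring
  let L2 : ℝ × ℝ × ℝ →L[ℝ] ℝ :=
    (ContinuousLinearMap.fst ℝ ℝ ℝ).comp (ContinuousLinearMap.snd ℝ ℝ (ℝ × ℝ))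
  let L3 : ℝ × ℝ × ℝ →L[ℝ] ℝ :=
    (ContinuousLinearMap.snd ℝ ℝ ℝ).comp (ContinuousLinearMap.snd ℝ ℝ (ℝ × ℝ))
  have h2 := (uniformSymbol_jap_rpow (ι := Set.Icc (0 : ℝ) 1) (-s)).comp_clm (fun _ => L2)
    (fun _ => le_rfl) (w' := fun z : ℝ × ℝ × ℝ => jap z.2.1 ^ (-s)) fun _ z => le_rfl
  have h3 := (uniformSymbol_jap_rpow (ι := Set.Icc (0 : ℝ) 1) (-s)).comp_clm (fun _ => L3)
    (fun _ => le_rfl) (w' := fun z : ℝ × ℝ × ℝ => jap z.2.2 ^ (-s)) fun _ z => le_rfl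
  refine UniformSymbol.congr ((h1.mul (h2.mul h3)).mono (c := 2 ^ |2 * s| * 2 ^ |s|)
    (by positivity) fun z => ?_) fun t z => by rw [segCLM_apply]; rfl
  have h := jap_rpow_le (-s) z.2.2 z.2.1
  rw [abs_neg, ← neg_sub z.2.1, jap_neg] at h
  have k1 := jap_rpow_pos z.1 p
  have k2 := jap_rpow_pos z.2.1 (2 * s)
  have k3 := jap_rpow_pos z.2.1 (-s)
  have k4 := jap_rpow_pos (z.2.1 - z.2.2) |2 * s|
  calc _ ≤ 2 ^ |2 * s| * (jap z.1 ^ p * jap z.2.1 ^ (2 * s) *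
      jap (z.2.1 - z.2.2) ^ |2 * s|) * (jap z.2.1 ^ (-s) * (2 ^ |s| * jap z.2.1 ^ (-s) *
        jap (z.2.1 - z.2.2) ^ |s|)) := by gcongr
    _ = 2 ^ |2 * s| * 2 ^ |s| * (jap z.1 ^ p * (jap (z.2.1 - z.2.2) ^ |2 * s| *
        jap (z.2.1 - z.2.2) ^ |s|)) *
        (jap z.2.1 ^ (2 * s) * jap z.2.1 ^ (-s) * jap z.2.1 ^ (-s)) := by ring
    _ = _ := by
        rw [← Real.rpow_add (jap_pos _), ← Real.rpow_add (jap_pos _), ← Real.rpow_add (jap_pos _),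
          show 2 * s + -s + -s = 0 by ring, Real.rpow_zero, mul_one, abs_mul, abs_two,
          show 2 * |s| + |s| = 3 * |s| by ring, ampWeight]

lemma UniformSymbol.comp_fst {ι : Type*} {p : ℝ} {f : ι → ℝ → ℂ}
    (hf : UniformSymbol (fun x => jap x ^ p) f) :
    UniformSymbol (ampWeight p 0) fun i z => f i z.1 :=
  hf.comp_clm (fun _ => ContinuousLinearMap.fst ℝ ℝ (ℝ × ℝ)) (fun _ => le_rfl)
    fun _ z => by simp [ampWeight]

lemma UniformSymbol.conj_swap {ι : Type*} {p d : ℝ} {B : ι → ℝ × ℝ × ℝ → ℂ}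
    (hB : UniformSymbol (ampWeight p d) B) :
    UniformSymbol (ampWeight p d) fun i z => conj (B i (z.1, z.2.2, z.2.1)) := by
  let S : ℝ × ℝ × ℝ →L[ℝ] ℝ × ℝ × ℝ :=
    (ContinuousLinearMap.fst ℝ ℝ (ℝ × ℝ)).prod
      (((ContinuousLinearMap.snd ℝ ℝ ℝ).prod (ContinuousLinearMap.fst ℝ ℝ ℝ)).comp
        (ContinuousLinearMap.snd ℝ ℝ (ℝ × ℝ)))
  refine (hB.comp_clm (fun _ => S) (fun _ => le_rfl) fun _ z => ?_).clm_comp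
    (conjCLE : ℂ →L[ℝ] ℂ)
  change jap z.1 ^ p * jap (z.2.2 - z.2.1) ^ d ≤ jap z.1 ^ p * jap (z.2.1 - z.2.2) ^ d
  rw [← neg_sub z.2.1, jap_neg]

/-- Amplitudes of order `p` in `x` and `d` in `ξ - η`, uniformly in the parameter, each of which
moreover is integrable in `x`. -/
def IsAmplitude {ι : Type*} (p d : ℝ) (B : ι → ℝ × ℝ × ℝ → ℂ) : Prop :=
  UniformSymbol (ampWeight p d) B ∧ ∀ i, UniformSymbol (ampWeight (-2) d) fun _ : Unit => B i

namespace IsAmplitude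

variable {ι : Type*} {p d : ℝ} {B B' : ι → ℝ × ℝ × ℝ → ℂ}

lemma contDiff (hB : IsAmplitude p d B) (i : ι) : ContDiff ℝ ∞ (B i) := hB.1.1 i

lemma mono_right (hB : IsAmplitude p d B) {d' : ℝ} (hd : d ≤ d') : IsAmplitude p d' B :=
  ⟨hB.1.mono zero_le_one fun z => by simpa using ampWeight_mono le_rfl hd z,
    fun i => (hB.2 i).mono zero_le_one fun z => by simpa using ampWeight_mono le_rfl hd z⟩

lemma sub (hB : IsAmplitude p d B) (hB' : IsAmplitude p d B') :
    IsAmplitude p d fun i z => B i z - B' i z :=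
  ⟨hB.1.sub hB'.1, fun i => (hB.2 i).sub (hB'.2 i)⟩

lemma dirDeriv (hB : IsAmplitude p d B) (v : ℝ × ℝ × ℝ) :
    IsAmplitude p d fun i => dirDeriv v (B i) :=
  ⟨hB.1.fderiv_apply v, fun i => (hB.2 i).fderiv_apply v⟩

lemma mul_res (hB : IsAmplitude p d B) :
    IsAmplitude p (d - 1) fun i z => B i z * res (z.2.1 - z.2.2) := by
  refine ⟨(hB.1.mul uniformSymbol_res_freqDiff).mono zero_le_one fun z => ?_,
    fun i => ((hB.2 i).mul uniformSymbol_res_freqDiff).mono zero_le_one fun z => ?_⟩ <;>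
  · rw [ampWeight_mul, add_zero, one_mul, sub_eq_add_neg]

end IsAmplitude

/-- The amplitude produced by one integration by parts in `x`. -/
noncomputable def stepX (B : ℝ × ℝ × ℝ → ℂ) (z : ℝ × ℝ × ℝ) : ℂ :=
  B z * res (z.2.1 - z.2.2) - dirDeriv (1, 0, 0) (fun z => B z * res (z.2.1 - z.2.2)) z

lemma IsAmplitude.stepX {ι : Type*} {p d : ℝ} {B : ι → ℝ × ℝ × ℝ → ℂ}
    (hB : IsAmplitude p d B) : IsAmplitude p (d - 1) fun i => stepX (B i) :=
  hB.mul_res.sub (hB.mul_res.dirDeriv _)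

/-- The amplitude of the regularized first-order difference quotient. -/
noncomputable def quotAmp (σ s : ℝ) (b : ℝ × ℝ → ℂ) (ε t : ℝ) (z : ℝ × ℝ × ℝ) : ℂ :=
  damp σ ε z.1 * (b (z.1, z.2.2 + t * (z.2.1 - z.2.2)) *
    (((jap z.2.1 ^ (-s) : ℝ) : ℂ) * ((jap z.2.2 ^ (-s) : ℝ) : ℂ)))

/-- The `x`-derivative of `quotAmp`. -/
noncomputable def gainAmp (σ s : ℝ) (b c : ℝ × ℝ → ℂ) (ε t : ℝ) (z : ℝ × ℝ × ℝ) : ℂ :=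
  dampDeriv σ ε z.1 * (b (z.1, z.2.2 + t * (z.2.1 - z.2.2)) *
    (((jap z.2.1 ^ (-s) : ℝ) : ℂ) * ((jap z.2.2 ^ (-s) : ℝ) : ℂ))) +
  quotAmp σ s c ε t z

lemma uniformSymbol_quotAmp {p s σ : ℝ} {f : ℝ × ℝ → ℂ} (hσ : 0 ≤ σ) (hp : p - σ ≤ -2)
    (hf : UniformSymbol (fun z => jap z.1 ^ p * jap z.2 ^ (2 * s)) fun _ : Unit => f)
    {ε : ℝ} (hε : ε ∈ Set.Ioc (0 : ℝ) 1) :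
    UniformSymbol (ampWeight (-2) (3 * |s|)) fun t : Set.Icc (0 : ℝ) 1 => quotAmp σ s f ε t := by
  refine ((uniformSymbol_damp_decay hσ hε).comp_fst.mul
    (uniformSymbol_comp_segCLM hf)).mono zero_le_one fun z => ?_
  rw [ampWeight_mul, one_mul]
  exact ampWeight_mono (by linarith) (by linarith) z

lemma isAmplitude_gainAmp {q s σ : ℝ} {b c : ℝ × ℝ → ℂ} (hσ : 0 ≤ σ) (hq : q - σ ≤ -2)
    (hb : UniformSymbol (fun z => jap z.1 ^ q * jap z.2 ^ (2 * s)) fun _ : Unit => b)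
    (hc : UniformSymbol (fun z => jap z.1 ^ (q - 1) * jap z.2 ^ (2 * s)) fun _ : Unit => c) :
    IsAmplitude (q - 1) (3 * |s|) fun i : Set.Ioc (0 : ℝ) 1 × Set.Icc (0 : ℝ) 1 =>
      gainAmp σ s b c i.1 i.2 := by
  have hb' := uniformSymbol_comp_segCLM hb
  have hc' := uniformSymbol_comp_segCLM hc
  have e0 : UniformSymbol (fun x => jap x ^ (0 : ℝ)) fun ε : Set.Ioc (0 : ℝ) 1 => damp σ ε :=
    (uniformSymbol_damp hσ).mono zero_le_one (by simp)
  have e1 : UniformSymbol (fun x => jap x ^ (-1 : ℝ)) fun ε : Set.Ioc (0 : ℝ) 1 =>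
      dampDeriv σ ε :=
    (uniformSymbol_dampDeriv hσ).mono zero_le_one (by simp [Real.rpow_neg_one])
  refine ⟨UniformSymbol.add ?_ ?_, fun i => UniformSymbol.add ?_ ?_⟩
  · refine ((e1.comp_fst.reindex Prod.fst).mul (hb'.reindex Prod.snd)).mono
      zero_le_one fun z => ?_
    rw [ampWeight_mul, one_mul]
    exact ampWeight_mono (by linarith) (by linarith) z
  · refine ((e0.comp_fst.reindex Prod.fst).mul (hc'.reindex Prod.snd)).mono
      zero_le_one fun z => ?_
    rw [ampWeight_mul, one_mul]
    exact ampWeight_mono (by linarith) (by linarith) z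
  · refine ((uniformSymbol_dampDeriv_decay hσ i.1.2).comp_fst.mul
      (hb'.reindex fun _ => i.2)).mono zero_le_one fun z => ?_
    rw [ampWeight_mul, one_mul]
    exact ampWeight_mono (by linarith) (by linarith) z
  · exact (uniformSymbol_quotAmp hσ (by linarith) hc i.1.2).reindex fun _ => i.2

lemma hasDerivAt_quotAmp {σ s : ℝ} {b c : ℝ × ℝ → ℂ}
    (hbc : ∀ x ξ, HasDerivAt (fun x => b (x, ξ)) (c (x, ξ)) x) (ε t x : ℝ) (w : ℝ × ℝ) :
    HasDerivAt (fun x => quotAmp σ s b ε t (x, w)) (gainAmp σ s b c ε t (x, w)) x :=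
  (hasDerivAt_damp σ ε x).mul ((hbc x (w.2 + t * (w.1 - w.2))).mul_const
    (((jap w.1 ^ (-s) : ℝ) : ℂ) * ((jap w.2 ^ (-s) : ℝ) : ℂ)))

end Amplitude

section OscillatoryIntegral

/-- The integrand of the sesquilinear form with amplitude `B` acting on a pair of functions. -/
noncomputable def osc (B : ℝ × ℝ × ℝ → ℂ) (f g : ℝ → ℂ) (z : ℝ × ℝ × ℝ) : ℂ :=
  B z * (exp ((z.1 * (z.2.1 - z.2.2) : ℝ) * I) * (f z.2.1 * conj (g z.2.2)))

lemma norm_osc (B : ℝ × ℝ × ℝ → ℂ) (f g : ℝ → ℂ) (z : ℝ × ℝ × ℝ) :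
    ‖osc B f g z‖ = ‖B z‖ * (‖f z.2.1‖ * ‖g z.2.2‖) := by
  rw [osc, norm_mul, norm_mul, norm_exp_ofReal_mul_I, one_mul, norm_mul, RCLike.norm_conj]

lemma continuous_osc {B : ℝ × ℝ × ℝ → ℂ} {f g : ℝ → ℂ} (hB : Continuous B) (hf : Continuous f)
    (hg : Continuous g) : Continuous (osc B f g) := by
  have h1 : Continuous fun z : ℝ × ℝ × ℝ => conj (g z.2.2) :=
    Complex.continuous_conj.comp (hg.comp (continuous_snd.comp continuous_snd))
  have h2 : Continuous fun z : ℝ × ℝ × ℝ => f z.2.1 :=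
    hf.comp (continuous_fst.comp continuous_snd)
  unfold osc
  fun_prop

/-- Multiplication of a Schwartz function by `⟨x⟩^s`. -/
noncomputable def japMul (s : ℝ) (f : 𝓢(ℝ, ℂ)) : 𝓢(ℝ, ℂ) :=
  smulLeftCLM ℂ (fun x => ((jap x ^ s : ℝ) : ℂ)) f

lemma japMul_apply (s : ℝ) (f : 𝓢(ℝ, ℂ)) (x : ℝ) : japMul s f x = ((jap x ^ s : ℝ) : ℂ) * f x :=
  smulLeftCLM_apply_apply
    ((uniformSymbol_jap_rpow (ι := Unit) s).hasTemperateGrowth ()) f x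

lemma norm_japMul (s : ℝ) (f : 𝓢(ℝ, ℂ)) (x : ℝ) : ‖japMul s f x‖ = jap x ^ s * ‖f x‖ := by
  rw [japMul_apply, norm_mul, norm_jap_rpow]

lemma integrable_jap_neg_two : Integrable fun x => jap x ^ (-2 : ℝ) := by
  refine integrable_inv_one_add_sq.congr (Filter.Eventually.of_forall fun x => ?_)
  change (1 + x ^ 2)⁻¹ = jap x ^ (-2 : ℝ)
  rw [Real.rpow_neg (jap_pos x).le, Real.rpow_two, jap_sq]

/-- Decay of order two in `x` with at most polynomial growth in the frequencies. -/
def PolyBound (F : ℝ × ℝ × ℝ → ℂ) : Prop :=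
  ∃ C D : ℝ, 0 ≤ C ∧ 0 ≤ D ∧
    ∀ z, ‖F z‖ ≤ C * (jap z.1 ^ (-2 : ℝ) * (jap z.2.1 * jap z.2.2) ^ D)

namespace PolyBound

variable {F F' : ℝ × ℝ × ℝ → ℂ}

lemma add (h : PolyBound F) (h' : PolyBound F') : PolyBound fun z => F z + F' z := by
  obtain ⟨C, D, hC, hD, hb⟩ := h
  obtain ⟨C', D', hC', hD', hb'⟩ := h'
  refine ⟨C + C', max D D', by positivity, le_max_of_le_left hD, fun z => ?_⟩
  have h1 : 1 ≤ jap z.2.1 * jap z.2.2 :=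
    one_le_mul_of_one_le_of_one_le (one_le_jap _) (one_le_jap _)
  have h2 := jap_rpow_pos z.1 (-2)
  calc _ ≤ ‖F z‖ + ‖F' z‖ := norm_add_le _ _
    _ ≤ C * (jap z.1 ^ (-2 : ℝ) * (jap z.2.1 * jap z.2.2) ^ max D D') +
        C' * (jap z.1 ^ (-2 : ℝ) * (jap z.2.1 * jap z.2.2) ^ max D D') := by
        refine add_le_add ((hb z).trans ?_) ((hb' z).trans ?_)
        · gcongr
          exact le_max_left _ _
        · gcongr
          exact le_max_right _ _
    _ = _ := by ring

lemma freq_mul (h : PolyBound F) : PolyBound fun z => I * ((z.2.1 - z.2.2 : ℝ) : ℂ) * F z := by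
  obtain ⟨C, D, hC, hD, hb⟩ := h
  refine ⟨2 * C, 1 + D, by positivity, by positivity, fun z => ?_⟩
  have h1 : 0 < jap z.2.1 * jap z.2.2 := mul_pos (jap_pos _) (jap_pos _)
  rw [norm_mul, norm_mul, norm_I, one_mul, norm_real, Real.norm_eq_abs, Real.rpow_add h1,
    Real.rpow_one]
  have h2 : |z.2.1 - z.2.2| ≤ 2 * (jap z.2.1 * jap z.2.2) := by
    refine (abs_le_jap _).trans ?_
    simpa [sub_eq_add_neg, jap_neg] using jap_add_le z.2.1 (-z.2.2)
  calc _ ≤ (2 * (jap z.2.1 * jap z.2.2)) *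
      (C * (jap z.1 ^ (-2 : ℝ) * (jap z.2.1 * jap z.2.2) ^ D)) :=
        mul_le_mul h2 (hb z) (norm_nonneg _) (by positivity)
    _ = _ := by ring

end PolyBound

lemma ampWeight_le (p d : ℝ) (z : ℝ × ℝ × ℝ) :
    ampWeight p d z ≤ 2 ^ |d| * (jap z.1 ^ p * (jap z.2.1 * jap z.2.2) ^ |d|) := by
  have h1 := jap_rpow_pos z.1 p
  have h2 : jap (z.2.1 - z.2.2) ≤ 2 * (jap z.2.1 * jap z.2.2) := by
    simpa [sub_eq_add_neg, jap_neg] using jap_add_le z.2.1 (-z.2.2)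
  have h3 := jap_pos z.2.1
  have h4 := jap_pos z.2.2
  calc ampWeight p d z ≤ jap z.1 ^ p * (2 * (jap z.2.1 * jap z.2.2)) ^ |d| := by
        refine mul_le_mul_of_nonneg_left ?_ h1.le
        refine (Real.rpow_le_rpow_of_exponent_le (one_le_jap _) (le_abs_self d)).trans ?_
        exact Real.rpow_le_rpow (jap_pos _).le h2 (abs_nonneg d)
    _ = _ := by
        rw [Real.mul_rpow (by norm_num) (by positivity)]
        ring

lemma UniformSymbol.exists_polyBound {ι : Type*} {d : ℝ} {F : ι → ℝ × ℝ × ℝ → ℂ}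
    (h : UniformSymbol (ampWeight (-2) d) F) :
    ∃ C D : ℝ, 0 ≤ C ∧ 0 ≤ D ∧
      ∀ i z, ‖F i z‖ ≤ C * (jap z.1 ^ (-2 : ℝ) * (jap z.2.1 * jap z.2.2) ^ D) := by
  obtain ⟨C, hC, hb⟩ := h.bound
  refine ⟨C * 2 ^ |d|, |d|, by positivity, abs_nonneg d, fun i z => (hb i z).trans ?_⟩
  rw [mul_assoc]
  exact mul_le_mul_of_nonneg_left (ampWeight_le _ _ z) hC

lemma UniformSymbol.polyBound {d : ℝ} {F : ℝ × ℝ × ℝ → ℂ}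
    (h : UniformSymbol (ampWeight (-2) d) fun _ : Unit => F) : PolyBound F := by
  obtain ⟨C, D, hC, hD, hb⟩ := h.exists_polyBound
  exact ⟨C, D, hC, hD, hb ()⟩

/-- The integrable function dominating the oscillatory integrand. -/
noncomputable def oscBound (C D : ℝ) (f g : ℝ → ℂ) (z : ℝ × ℝ × ℝ) : ℝ :=
  C * (jap z.1 ^ (-2 : ℝ) * (jap z.2.1 ^ D * ‖f z.2.1‖ * (jap z.2.2 ^ D * ‖g z.2.2‖)))

lemma integrable_oscBound (C D : ℝ) (f g : 𝓢(ℝ, ℂ)) : Integrable (oscBound C D f g) := by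
  have h : ∀ h : 𝓢(ℝ, ℂ), Integrable fun x => jap x ^ D * ‖h x‖ := fun h =>
    (japMul D h).integrable.norm.congr (Filter.Eventually.of_forall fun x => norm_japMul D h x)
  exact (integrable_jap_neg_two.mul_prod ((h f).mul_prod (h g))).const_mul C

lemma norm_osc_le {F : ℝ × ℝ × ℝ → ℂ} {C D : ℝ}
    (h : ∀ z, ‖F z‖ ≤ C * (jap z.1 ^ (-2 : ℝ) * (jap z.2.1 * jap z.2.2) ^ D)) (f g : ℝ → ℂ)
    (z : ℝ × ℝ × ℝ) : ‖osc F f g z‖ ≤ oscBound C D f g z := by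
  rw [norm_osc]
  calc _ ≤ (C * (jap z.1 ^ (-2 : ℝ) * (jap z.2.1 * jap z.2.2) ^ D)) *
        (‖f z.2.1‖ * ‖g z.2.2‖) := mul_le_mul_of_nonneg_right (h z) (by positivity)
    _ = _ := by
      rw [oscBound, Real.mul_rpow (jap_pos _).le (jap_pos _).le]
      ring

lemma PolyBound.integrable_osc {F : ℝ × ℝ × ℝ → ℂ} (h : PolyBound F) (hF : Continuous F)
    (f g : 𝓢(ℝ, ℂ)) : Integrable (osc F f g) := by
  obtain ⟨C, D, -, -, hb⟩ := h
  exact (integrable_oscBound C D f g).mono'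
    (continuous_osc hF f.continuous g.continuous).aestronglyMeasurable
    (Filter.Eventually.of_forall (norm_osc_le hb f g))

lemma PolyBound.integrable_slice {F : ℝ × ℝ × ℝ → ℂ} (h : PolyBound F) (hF : Continuous F)
    (w : ℝ × ℝ) : Integrable fun x => F (x, w) := by
  obtain ⟨C, D, -, -, hb⟩ := h
  refine ((integrable_jap_neg_two.mul_const ((jap w.1 * jap w.2) ^ D)).const_mul C).mono'
    (by fun_prop) (Filter.Eventually.of_forall fun x => hb (x, w))

/-- Integration by parts in `x`. -/
lemma integral_osc_deriv {F F' : ℝ × ℝ × ℝ → ℂ} (hF : Continuous F) (hF' : Continuous F')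
    (h : PolyBound F) (h' : PolyBound F')
    (hd : ∀ x w, HasDerivAt (fun x => F (x, w)) (F' (x, w)) x) (f g : 𝓢(ℝ, ℂ)) :
    ∫ z, osc (fun z => F' z + I * ((z.2.1 - z.2.2 : ℝ) : ℂ) * F z) f g z = 0 := by
  have hc : Continuous fun z : ℝ × ℝ × ℝ =>
      F' z + I * ((z.2.1 - z.2.2 : ℝ) : ℂ) * F z := by fun_prop
  have hi := (h'.add h.freq_mul).integrable_osc hc f g
  rw [Measure.volume_eq_prod] at hi ⊢
  rw [integral_prod_symm _ hi]
  refine integral_eq_zero_of_ae (Filter.Eventually.of_forall fun w => ?_)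
  have he : ∀ x : ℝ, HasDerivAt (fun x : ℝ => exp ((x * (w.1 - w.2) : ℝ) * I))
      (exp ((x * (w.1 - w.2) : ℝ) * I) * (((w.1 - w.2 : ℝ) : ℂ) * I)) x := fun x => by
    have h0 : HasDerivAt (fun x : ℝ => ((x * (w.1 - w.2) : ℝ) : ℂ) * I)
        (((w.1 - w.2 : ℝ) : ℂ) * I) x := by
      have := ((hasDerivAt_id x).mul_const (w.1 - w.2)).ofReal_comp.mul_const I
      simpa using this
    exact h0.cexp
  have hd' : ∀ x, HasDerivAt
      (fun x : ℝ => F (x, w) * (exp ((x * (w.1 - w.2) : ℝ) * I) * (f w.1 * conj (g w.2))))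
      (osc (fun z => F' z + I * ((z.2.1 - z.2.2 : ℝ) : ℂ) * F z) f g (x, w)) x := fun x => by
    refine ((hd x w).mul ((he x).mul_const (f w.1 * conj (g w.2)))).congr_deriv ?_
    simp only [osc]
    ring
  have hn : ∀ G : ℝ × ℝ × ℝ → ℂ, Continuous G → PolyBound G → Integrable fun x : ℝ =>
      G (x, w) * (exp ((x * (w.1 - w.2) : ℝ) * I) * (f w.1 * conj (g w.2))) := fun G hG hp => by
    refine ((hp.integrable_slice hG w).mul_const (f w.1 * conj (g w.2))).mono
      (by fun_prop) (Filter.Eventually.of_forall fun x => ?_)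
    rw [norm_mul, norm_mul, norm_exp_ofReal_mul_I, one_mul, norm_mul (G _)]
  exact integral_eq_zero_of_hasDerivAt_of_integrable hd'
    (hn _ hc (h'.add h.freq_mul)) (hn F hF h)

lemma integral_osc_stepX {B : ℝ × ℝ × ℝ → ℂ} {d : ℝ}
    (hB : UniformSymbol (ampWeight (-2) d) fun _ : Unit => B) (f g : 𝓢(ℝ, ℂ)) :
    ∫ z, osc (stepX B) f g z = ∫ z, osc B f g z := by
  have hR : UniformSymbol (ampWeight (-2) (d - 1))
      fun (_ : Unit) (z : ℝ × ℝ × ℝ) => B z * res (z.2.1 - z.2.2) :=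
    (IsAmplitude.mul_res (p := -2) ⟨hB, fun _ => hB⟩).1
  have hD := hR.fderiv_apply (1, 0, 0)
  have hS : UniformSymbol (ampWeight (-2) (d - 1)) fun _ : Unit => stepX B := hR.sub hD
  have hcB := (hB.1 ()).continuous
  have hcS := (hS.1 ()).continuous
  have key := integral_osc_deriv (hR.1 ()).continuous (hD.1 ()).continuous hR.polyBound
    hD.polyBound (fun x w => hasDerivAt_fst (hR.1 ()) x w) f g
  rw [← sub_eq_zero, ← neg_eq_zero, neg_sub, ← integral_sub (hB.polyBound.integrable_osc hcB f g)
    (hS.polyBound.integrable_osc hcS f g), ← key]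
  congr 1
  funext z
  simp only [osc, stepX, dirDeriv]
  have h1 : (1 + I * ((z.2.1 - z.2.2 : ℝ) : ℂ)) * res (z.2.1 - z.2.2) = 1 :=
    mul_inv_cancel₀ (one_add_I_mul_ne_zero _)
  linear_combination (-(B z * (exp ((z.1 * (z.2.1 - z.2.2) : ℝ) * I) *
    (f z.2.1 * conj (g z.2.2))))) * h1

lemma IsAmplitude.exists_iterate_stepX {ι : Type*} {p d : ℝ} {B : ι → ℝ × ℝ × ℝ → ℂ}
    (hB : IsAmplitude p d B) (n : ℕ) :
    ∃ B' : ι → ℝ × ℝ × ℝ → ℂ, IsAmplitude p (d - n) B' ∧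
      ∀ i, ∀ f g : 𝓢(ℝ, ℂ), ∫ z, osc (B' i) f g z = ∫ z, osc (B i) f g z := by
  induction n with
  | zero => exact ⟨B, by simpa using hB, fun _ _ _ => rfl⟩
  | succ n ih =>
    obtain ⟨B', hB', h⟩ := ih
    refine ⟨fun i => _root_.stepX (B' i), ?_, fun i f g => ?_⟩
    · rw [Nat.cast_succ, ← sub_sub]
      exact hB'.stepX
    · rw [integral_osc_stepX (hB'.2 i), h]

end OscillatoryIntegral

section FourierTransform

/-- Dilation of the line by `2π`. -/
noncomputable def dilation : ℝ ≃L[ℝ] ℝ :=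
  ContinuousLinearEquiv.unitsEquivAut ℝ (Units.mk0 (2 * Real.pi) (by positivity))

lemma dilation_apply (x : ℝ) : dilation x = 2 * Real.pi * x := by
  simp [dilation, mul_comm]

lemma dilation_symm_apply (x : ℝ) : dilation.symm x = (2 * Real.pi)⁻¹ * x := by
  rw [ContinuousLinearEquiv.symm_apply_eq, dilation_apply]
  field_simp

/-- The Fourier transform `FT` as an operator on Schwartz functions. -/
noncomputable def fourierS : 𝓢(ℝ, ℂ) →L[ℂ] 𝓢(ℝ, ℂ) :=
  (compCLMOfContinuousLinearEquiv ℂ dilation.symm).comp (fourierTransformCLM ℂ)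

lemma fourierS_eq (W : 𝓢(ℝ, ℂ)) (ξ : ℝ) : fourierS W ξ = 𝓕 (W : ℝ → ℂ) ((2 * Real.pi)⁻¹ * ξ) := by
  rw [← dilation_symm_apply]
  rfl

lemma fourierS_apply (W : 𝓢(ℝ, ℂ)) (ξ : ℝ) : fourierS W ξ = FT (fun y => W y) ξ := by
  rw [fourierS_eq, Real.fourier_real_eq_integral_exp_smul, FT]
  congr 1
  funext y
  rw [smul_eq_mul]
  congr 2
  rw [show -2 * Real.pi * y * ((2 * Real.pi)⁻¹ * ξ) = -(y * ξ) by field_simp]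
  push_cast
  ring

/-- The inverse of `fourierS`. -/
noncomputable def fourierSInv (φ : 𝓢(ℝ, ℂ)) : 𝓢(ℝ, ℂ) :=
  𝓕⁻ (compCLMOfContinuousLinearEquiv ℂ dilation φ)

lemma fourierS_fourierSInv (φ : 𝓢(ℝ, ℂ)) : fourierS (fourierSInv φ) = φ := by
  have h : 𝓕 (fourierSInv φ) = compCLMOfContinuousLinearEquiv ℂ dilation φ :=
    FourierTransform.fourier_fourierInv_eq _
  ext ξ
  change 𝓕 (fourierSInv φ) (dilation.symm ξ) = φ ξ
  rw [h]
  simp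

lemma fourierSInv_fourierS (W : 𝓢(ℝ, ℂ)) : fourierSInv (fourierS W) = W := by
  have h : compCLMOfContinuousLinearEquiv ℂ dilation (fourierS W) = 𝓕 W := by
    ext ξ
    change 𝓕 W (dilation.symm (dilation ξ)) = _
    simp
  rw [fourierSInv, h]
  exact FourierTransform.fourierInv_fourier_eq _

lemma FTinv_eq (φ : 𝓢(ℝ, ℂ)) (x : ℝ) : FTinv (fun ξ => φ ξ) x = fourierSInv φ x := by
  rw [fourierSInv, fourierInv_coe, Real.fourierInv_eq', FTinv]
  have h := Measure.integral_comp_mul_left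
    (fun ξ : ℝ => exp (I * (x : ℂ) * (ξ : ℂ)) * φ ξ) (2 * Real.pi)
  rw [abs_of_pos (by positivity)] at h
  rw [← h]
  congr 1
  funext w
  rw [smul_eq_mul, compCLMOfContinuousLinearEquiv_apply, Function.comp_apply, dilation_apply]
  congr 2
  simp
  ring

lemma integral_norm_sq_fourierS (W : 𝓢(ℝ, ℂ)) :
    ∫ ξ, ‖fourierS W ξ‖ ^ 2 = 2 * Real.pi * ∫ x, ‖W x‖ ^ 2 := by
  have h := Measure.integral_comp_mul_left
    (fun ξ : ℝ => ‖𝓕 (W : ℝ → ℂ) ξ‖ ^ 2) (2 * Real.pi)⁻¹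
  simp_rw [fourierS_eq]
  rw [h, inv_inv, abs_of_pos (by positivity), smul_eq_mul, ← integral_norm_sq_fourier W]
  rfl

lemma hasDerivAt_fourierS {V V' : 𝓢(ℝ, ℂ)} (h : ∀ y, V' y = -I * y * V y) (ξ : ℝ) :
    HasDerivAt (fourierS V) (fourierS V' ξ) ξ := by
  have hi : Integrable fun y : ℝ => y • V y := by
    refine (V'.integrable.const_mul I).congr (Filter.Eventually.of_forall fun y => ?_)
    simp only [h, real_smul]
    linear_combination -(y * V y) * I_mul_I
  have h1 := Real.hasDerivAt_fourier V.integrable hi ((2 * Real.pi)⁻¹ * ξ)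
  have h2 : HasDerivAt (fun ξ : ℝ => (2 * Real.pi)⁻¹ * ξ) (2 * Real.pi)⁻¹ ξ := by
    simpa using (hasDerivAt_id ξ).const_mul (2 * Real.pi)⁻¹
  have h3 := h1.scomp ξ h2
  rw [show (fourierS V : ℝ → ℂ) = 𝓕 (V : ℝ → ℂ) ∘ fun ξ : ℝ => (2 * Real.pi)⁻¹ * ξ from
    funext fun ξ => fourierS_eq V ξ]
  refine h3.congr_deriv ?_
  rw [fourierS_eq, Real.fourier_real_eq, Real.fourier_real_eq, ← integral_smul]
  congr 1
  funext y
  rw [h, smul_comm, smul_eq_mul, real_smul]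
  congr 1
  have := Real.pi_ne_zero
  push_cast
  have h5 : (Real.pi : ℂ) ≠ 0 := by exact_mod_cast this
  field_simp

/-- Multiplication of a Schwartz function by the resolvent `(1 + i (x - y))⁻¹`. -/
noncomputable def resMul (x : ℝ) (W : 𝓢(ℝ, ℂ)) : 𝓢(ℝ, ℂ) :=
  smulLeftCLM ℂ (fun y => res (x - y)) W

lemma resMul_apply (x : ℝ) (W : 𝓢(ℝ, ℂ)) (y : ℝ) : resMul x W y = res (x - y) * W y := by
  refine smulLeftCLM_apply_apply ?_ W y
  have h : UniformSymbol (fun x => jap x ^ (-1 : ℝ)) fun _ : Unit => res :=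
    uniformSymbol_res.mono zero_le_one fun z => by simp [Real.rpow_neg_one]
  exact (h.hasTemperateGrowth ()).comp ((Function.HasTemperateGrowth.const x).sub .id')

lemma norm_iterate_resMul (x : ℝ) (W : 𝓢(ℝ, ℂ)) (n : ℕ) (y : ℝ) :
    ‖(resMul x)^[n] W y‖ = (jap (x - y))⁻¹ ^ n * ‖W y‖ := by
  induction n with
  | zero => simp
  | succ n ih =>
    rw [Function.iterate_succ_apply', resMul_apply, norm_mul, norm_res, ih]
    ring

lemma hasDerivAt_fourierS_resMul (x : ℝ) (W : 𝓢(ℝ, ℂ)) (ξ : ℝ) :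
    HasDerivAt (fourierS (resMul x W))
      (fourierS W ξ - (1 + I * x) * fourierS (resMul x W) ξ) ξ := by
  have h := hasDerivAt_fourierS (V := resMul x W) (V' := W - (1 + I * (x : ℂ)) • resMul x W)
    (fun y => ?_) ξ
  · rw [map_sub, map_smul] at h
    exact h
  · have h1 : (1 + I * ((x - y : ℝ) : ℂ)) * res (x - y) = 1 :=
      mul_inv_cancel₀ (one_add_I_mul_ne_zero _)
    change W y - (1 + I * (x : ℂ)) * resMul x W y = _
    rw [resMul_apply]
    push_cast at h1
    linear_combination -(W y) * h1

end FourierTransform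

section FrequencySteps

lemma integrable_osc_slice {β : ℝ × ℝ × ℝ → ℂ} (hβ : Continuous β) {M x : ℝ}
    (hM : ∀ w, ‖β (x, w)‖ ≤ M) (f g : 𝓢(ℝ, ℂ)) : Integrable fun w => osc β f g (x, w) := by
  have hc := continuous_osc hβ f.continuous g.continuous
  refine ((f.integrable.norm.mul_prod g.integrable.norm).const_mul M).mono'
    (hc.comp (by fun_prop : Continuous fun w : ℝ × ℝ => (x, w))).aestronglyMeasurable
    (Filter.Eventually.of_forall fun w => ?_)
  rw [norm_osc]
  exact mul_le_mul_of_nonneg_right (hM w) (by positivity)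

lemma integrable_osc_line {β : ℝ × ℝ × ℝ → ℂ} (hβ : Continuous β) {M x : ℝ}
    (hM : ∀ w, ‖β (x, w)‖ ≤ M) (f g : 𝓢(ℝ, ℂ)) (η : ℝ) :
    Integrable fun ξ => osc β f g (x, ξ, η) := by
  have hc := continuous_osc hβ f.continuous g.continuous
  refine ((f.integrable.norm.mul_const ‖g η‖).const_mul M).mono'
    (hc.comp (by fun_prop : Continuous fun ξ : ℝ => (x, ξ, η))).aestronglyMeasurable
    (Filter.Eventually.of_forall fun ξ => ?_)
  rw [norm_osc]
  exact mul_le_mul_of_nonneg_right (hM _) (by positivity)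

/-- The amplitude produced by one integration by parts in the first frequency. -/
noncomputable def stepFreq (β : ℝ × ℝ × ℝ → ℂ) (z : ℝ × ℝ × ℝ) : ℂ :=
  β z - dirDeriv (0, 1, 0) β z

lemma integral_osc_stepFreq {β : ℝ × ℝ × ℝ → ℂ} (hβ : ContDiff ℝ ∞ β) {M x : ℝ}
    (hM : ∀ w, ‖β (x, w)‖ ≤ M) (hM' : ∀ w, ‖dirDeriv (0, 1, 0) β (x, w)‖ ≤ M)
    {f F : 𝓢(ℝ, ℂ)} (g : 𝓢(ℝ, ℂ))
    (hF : ∀ ξ, HasDerivAt F (f ξ - (1 + I * x) * F ξ) ξ) :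
    ∫ w, osc (stepFreq β) F g (x, w) = ∫ w, osc β f g (x, w) := by
  have hc := hβ.continuous
  have hc' := (hβ.dirDeriv (0, 1, 0)).continuous
  have hcs : Continuous (stepFreq β) := hc.sub hc'
  have hMs : ∀ w, ‖stepFreq β (x, w)‖ ≤ M + M := fun w =>
    (norm_sub_le _ _).trans (add_le_add (hM w) (hM' w))
  have hi1 := integrable_osc_slice hc hM f g
  have hi2 := integrable_osc_slice hcs hMs F g
  rw [eq_comm, ← sub_eq_zero, ← integral_sub hi1 hi2]
  have hi := hi1.sub hi2
  rw [Measure.volume_eq_prod] at hi ⊢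
  refine (integral_prod_symm _ hi).trans ?_
  refine integral_eq_zero_of_ae (Filter.Eventually.of_forall fun η => ?_)
  refine integral_eq_zero_of_hasDerivAt_of_integrable (f := fun ξ => osc β F g (x, ξ, η))
    (fun ξ => ?_) ((integrable_osc_line hc hM f g η).sub (integrable_osc_line hcs hMs F g η))
    (integrable_osc_line hc hM F g η)
  have hb : HasDerivAt (fun ξ => β (x, ξ, η)) (dirDeriv (0, 1, 0) β (x, ξ, η)) ξ :=
    ((hβ.differentiable (by simp)) (x, ξ, η)).hasFDerivAt.comp_hasDerivAt ξ
      ((hasDerivAt_const ξ x).prodMk ((hasDerivAt_id ξ).prodMk (hasDerivAt_const ξ η)))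
  have he : HasDerivAt (fun ξ : ℝ => exp ((x * (ξ - η) : ℝ) * I))
      (exp ((x * (ξ - η) : ℝ) * I) * ((x : ℂ) * I)) ξ := by
    have h0 : HasDerivAt (fun ξ : ℝ => ((x * (ξ - η) : ℝ) : ℂ) * I) ((x : ℂ) * I) ξ := by
      have := (((hasDerivAt_id ξ).sub_const η).const_mul x).ofReal_comp.mul_const I
      simpa using this
    exact h0.cexp
  refine (hb.mul (he.mul ((hF ξ).mul_const (conj (g η))))).congr_deriv ?_
  simp only [Pi.sub_apply, Pi.mul_apply, osc, stepFreq]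
  ring

lemma conj_integral_osc (β : ℝ × ℝ × ℝ → ℂ) (f g : ℝ → ℂ) (x : ℝ) :
    ∫ w, osc (fun z => conj (β (z.1, z.2.2, z.2.1))) g f (x, w) =
      conj (∫ w, osc β f g (x, w)) := by
  rw [← integral_conj, Measure.volume_eq_prod,
    ← integral_prod_swap (fun w => conj (osc β f g (x, w)))]
  congr 1
  funext w
  change conj (β (x, w.2, w.1)) * _ = conj (β (x, w.2, w.1) * _)
  simp only [Prod.fst_swap, Prod.snd_swap, map_mul, ← exp_conj, conj_ofReal, conj_I,
    RingHomCompTriple.comp_apply, RingHom.id_apply]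
  rw [show ((x * (w.2 - w.1) : ℝ) : ℂ) * -I = ((x * (w.1 - w.2) : ℝ) : ℂ) * I by
    push_cast
    ring]
  ring

lemma UniformSymbol.exists_slice_bound {ι : Type*} {p d : ℝ} (hd : d ≤ 0)
    {B : ι → ℝ × ℝ × ℝ → ℂ} (hB : UniformSymbol (ampWeight p d) B) (i : ι) (x : ℝ) :
    ∃ M, (∀ w, ‖B i (x, w)‖ ≤ M) ∧ ∀ w, ‖_root_.dirDeriv (0, 1, 0) (B i) (x, w)‖ ≤ M := by
  obtain ⟨C, hC, hb⟩ := hB.bound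
  obtain ⟨C', hC', hb'⟩ := (hB.fderiv_apply (0, 1, 0)).bound
  have hw : ∀ w, ampWeight p d (x, w) ≤ jap x ^ p := fun w =>
    mul_le_of_le_one_right (jap_rpow_pos _ _).le
      (Real.rpow_le_one_of_one_le_of_nonpos (one_le_jap _) hd)
  have hx := jap_rpow_pos x p
  refine ⟨(C + C') * jap x ^ p, fun w => (hb i _).trans ?_, fun w => (hb' i _).trans ?_⟩
  · exact mul_le_mul (by linarith) (hw w) (ampWeight_nonneg _ _ _) (by positivity)
  · exact mul_le_mul (by linarith) (hw w) (ampWeight_nonneg _ _ _) (by positivity)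

lemma UniformSymbol.exists_iterate_stepFreq {ι : Type*} {p d : ℝ} (hd : d ≤ 0)
    {B : ι → ℝ × ℝ × ℝ → ℂ} (hB : UniformSymbol (ampWeight p d) B) (n : ℕ) :
    ∃ B' : ι → ℝ × ℝ × ℝ → ℂ, UniformSymbol (ampWeight p d) B' ∧ ∀ i x, ∀ W : 𝓢(ℝ, ℂ),
      ‖∫ w, osc (B i) (fourierS W) (fourierS W) (x, w)‖ =
        ‖∫ w, osc (B' i) (fourierS ((resMul x)^[n] W)) (fourierS ((resMul x)^[n] W)) (x, w)‖ := by
  induction n with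
  | zero => exact ⟨B, hB, fun _ _ _ => rfl⟩
  | succ n ih =>
    obtain ⟨B₀, hB₀, h⟩ := ih
    let B₁ : ι → ℝ × ℝ × ℝ → ℂ := fun i => stepFreq (B₀ i)
    have hB₁ : UniformSymbol (ampWeight p d) B₁ := hB₀.sub (hB₀.fderiv_apply (0, 1, 0))
    let B₂ : ι → ℝ × ℝ × ℝ → ℂ := fun i z => conj (B₁ i (z.1, z.2.2, z.2.1))
    have hB₂ : UniformSymbol (ampWeight p d) B₂ := hB₁.conj_swap
    refine ⟨fun i => stepFreq (B₂ i), hB₂.sub (hB₂.fderiv_apply (0, 1, 0)), fun i x W => ?_⟩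
    rw [h, Function.iterate_succ_apply']
    obtain ⟨M, hM, hM'⟩ := hB₀.exists_slice_bound hd i x
    obtain ⟨M₂, hM₂, hM₂'⟩ := hB₂.exists_slice_bound hd i x
    have hF := hasDerivAt_fourierS_resMul x ((resMul x)^[n] W)
    rw [← integral_osc_stepFreq (hB₀.1 i) hM hM' _ hF,
      integral_osc_stepFreq (hB₂.1 i) hM₂ hM₂' _ hF, conj_integral_osc, RCLike.norm_conj]

lemma integrable_mul_comp_sub {f g : ℝ → ℝ} (hf : Integrable f) (hg : Integrable g) :
    Integrable fun w : ℝ × ℝ => f w.2 * g (w.1 - w.2) :=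
  hf.convolution_integrand (ContinuousLinearMap.mul ℝ ℝ) hg

lemma integral_mul_comp_sub {f g : ℝ → ℝ} (hf : Integrable f) (hg : Integrable g) :
    ∫ w : ℝ × ℝ, f w.2 * g (w.1 - w.2) = (∫ y, f y) * ∫ x, g x := by
  rw [Measure.volume_eq_prod, integral_prod_symm _ (integrable_mul_comp_sub hf hg)]
  simp_rw [integral_const_mul, integral_sub_right_eq_self g, integral_mul_const]

/-- The total mass of `⟨x⟩⁻²`. -/
noncomputable def japMass : ℝ := ∫ x, jap x ^ (-2 : ℝ)

lemma japMass_nonneg : 0 ≤ japMass := integral_nonneg fun x => (jap_rpow_pos x _).le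

lemma integrable_norm_sq (H : 𝓢(ℝ, ℂ)) (s : ℝ) : Integrable fun x => jap x ^ s * ‖H x‖ ^ 2 := by
  have h := (SchwartzMap.memLp (japMul (s / 2) H) 2 volume).integrable_norm_pow two_ne_zero
  refine h.congr (Filter.Eventually.of_forall fun x => ?_)
  simp only [norm_japMul]
  rw [mul_pow, ← Real.rpow_natCast, ← Real.rpow_mul (jap_pos x).le]
  norm_num

/-- Schur's estimate for the form with kernel `⟨ξ-η⟩⁻²`. -/
lemma norm_integral_osc_slice_le {β : ℝ × ℝ × ℝ → ℂ} {M x : ℝ} (hM : 0 ≤ M)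
    (h : ∀ w : ℝ × ℝ, ‖β (x, w)‖ ≤ M * jap (w.1 - w.2) ^ (-2 : ℝ)) (H : 𝓢(ℝ, ℂ)) :
    ‖∫ w, osc β H H (x, w)‖ ≤ M * (japMass * ∫ ξ, ‖H ξ‖ ^ 2) := by
  have hH : Integrable fun ξ => ‖H ξ‖ ^ 2 := by simpa using integrable_norm_sq H 0
  have i1 := integrable_mul_comp_sub hH integrable_jap_neg_two
  have e1 := integral_mul_comp_sub hH integrable_jap_neg_two
  have i2 := i1.swap
  have e2 := integral_prod_swap (μ := (volume : Measure ℝ)) (ν := (volume : Measure ℝ))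
    (fun w : ℝ × ℝ => ‖H w.2‖ ^ 2 * jap (w.1 - w.2) ^ (-2 : ℝ))
  rw [← Measure.volume_eq_prod, e1] at e2
  have key := norm_integral_le_of_norm_le ((i1.add i2).const_mul (M / 2))
    (f := fun w => osc β H H (x, w)) (Filter.Eventually.of_forall fun w => ?_)
  · refine key.trans (le_of_eq ?_)
    rw [integral_const_mul]
    have := integral_add i1 i2
    simp only [Pi.add_apply] at this ⊢
    rw [this, e1]
    simp only [Function.comp_apply] at e2 ⊢
    rw [e2, japMass]
    ring
  · rw [norm_osc]
    simp only [Pi.add_apply, Function.comp_apply, Prod.fst_swap, Prod.snd_swap]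
    rw [← neg_sub w.1 w.2, jap_neg]
    have hk := jap_rpow_pos (w.1 - w.2) (-2)
    calc _ ≤ (M * jap (w.1 - w.2) ^ (-2 : ℝ)) * (‖H w.1‖ * ‖H w.2‖) :=
          mul_le_mul_of_nonneg_right (h w) (by positivity)
      _ ≤ (M * jap (w.1 - w.2) ^ (-2 : ℝ)) * ((‖H w.1‖ ^ 2 + ‖H w.2‖ ^ 2) / 2) := by
          refine mul_le_mul_of_nonneg_left ?_ (by positivity)
          nlinarith [sq_nonneg (‖H w.1‖ - ‖H w.2‖)]
      _ = _ := by ring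

lemma jap_rpow_mul_inv_pow_le {p : ℝ} {n : ℕ} (hn : |p| + 2 ≤ n) (x y : ℝ) :
    jap x ^ p * ((jap (x - y))⁻¹ ^ n) ^ 2 ≤ 2 ^ |p| * (jap y ^ p * jap (x - y) ^ (-2 : ℝ)) := by
  have h := jap_rpow_le p x y
  have hy := jap_rpow_pos y p
  have hd := jap_pos (x - y)
  have h1 : ((jap (x - y))⁻¹ ^ n) ^ 2 = jap (x - y) ^ (-(n * 2 : ℝ)) := by
    rw [← pow_mul, inv_pow, Real.rpow_neg hd.le]
    congr 1
    exact_mod_cast (Real.rpow_natCast _ (n * 2)).symm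
  rw [h1]
  calc _ ≤ (2 ^ |p| * jap y ^ p * jap (x - y) ^ |p|) * jap (x - y) ^ (-(n * 2 : ℝ)) :=
        mul_le_mul_of_nonneg_right h (jap_rpow_pos _ _).le
    _ = 2 ^ |p| * (jap y ^ p * jap (x - y) ^ (|p| + -(n * 2 : ℝ))) := by
        rw [Real.rpow_add hd]
        ring
    _ ≤ _ := by
        gcongr
        · exact one_le_jap _
        · nlinarith [abs_nonneg p]

/-- The form with amplitude of order `p` in `x` is controlled by the weighted norm. -/
lemma IsAmplitude.exists_norm_integral_osc_le {ι : Type*} {p d : ℝ} {B : ι → ℝ × ℝ × ℝ → ℂ}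
    (hB : IsAmplitude p d B) :
    ∃ C, 0 ≤ C ∧ ∀ i, ∀ U : 𝓢(ℝ, ℂ), ‖∫ z, osc (B i) (fourierS U) (fourierS U) z‖ ≤
      C * ∫ y, jap y ^ p * ‖U y‖ ^ 2 := by
  obtain ⟨B₁, hB₁, h₁⟩ := hB.exists_iterate_stepX ⌈d + 2⌉₊
  replace hB₁ := hB₁.mono_right (d' := -2) (by linarith [Nat.le_ceil (d + 2)])
  obtain ⟨n, hn⟩ := exists_nat_ge (|p| + 2)
  obtain ⟨B₂, hB₂, h₂⟩ := hB₁.1.exists_iterate_stepFreq (by norm_num) n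
  obtain ⟨C, hC, hb⟩ := hB₂.bound
  have hm := japMass_nonneg
  refine ⟨C * (japMass * (2 * Real.pi) * 2 ^ |p|) * japMass, by positivity, fun i U => ?_⟩
  rw [← h₁]
  have hi := (hB₁.2 i).polyBound.integrable_osc (hB₁.contDiff i).continuous
    (fourierS U) (fourierS U)
  rw [Measure.volume_eq_prod] at hi ⊢
  rw [integral_prod _ hi]
  have hU := integrable_norm_sq U p
  have i1 := integrable_mul_comp_sub hU integrable_jap_neg_two
  have e1 := integral_mul_comp_sub hU integrable_jap_neg_two
  rw [Measure.volume_eq_prod] at i1 e1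
  rw [integral_prod _ i1] at e1
  have key := norm_integral_le_of_norm_le
    (i1.integral_prod_left.const_mul (C * (japMass * (2 * Real.pi) * 2 ^ |p|)))
    (f := fun x => ∫ w, osc (B₁ i) (fourierS U) (fourierS U) (x, w))
    (Filter.Eventually.of_forall fun x => ?_)
  · refine key.trans (le_of_eq ?_)
    rw [integral_const_mul, e1, japMass]
    ring
  · rw [h₂]
    have hx := jap_rpow_pos x p
    refine (norm_integral_osc_slice_le (M := C * jap x ^ p) (by positivity)
      (fun w => (hb i (x, w)).trans (le_of_eq ?_)) _).trans ?_
    · rw [ampWeight, mul_assoc]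
    · rw [integral_norm_sq_fourierS]
      have h3 : jap x ^ p * ∫ y, ‖(resMul x)^[n] U y‖ ^ 2 ≤
          2 ^ |p| * ∫ y, jap y ^ p * ‖U y‖ ^ 2 * jap (x - y) ^ (-2 : ℝ) := by
        rw [← integral_const_mul, ← integral_const_mul]
        have hV : Integrable fun y => ‖(resMul x)^[n] U y‖ ^ 2 := by
          simpa using integrable_norm_sq ((resMul x)^[n] U) 0
        refine integral_mono (hV.const_mul _) ?_ fun y => ?_
        · refine (hU.mul_bdd (c := 1) ?_ (Filter.Eventually.of_forall fun y => ?_)).const_mul _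
          · exact ((continuous_jap_rpow (-2)).comp (by fun_prop :
              Continuous fun y : ℝ => x - y)).aestronglyMeasurable
          · rw [Real.norm_of_nonneg (jap_rpow_pos _ _).le]
            exact Real.rpow_le_one_of_one_le_of_nonpos (one_le_jap _) (by norm_num)
        · simp only [norm_iterate_resMul, mul_pow _ ‖U y‖]
          have := mul_le_mul_of_nonneg_right (jap_rpow_mul_inv_pow_le hn x y)
            (sq_nonneg ‖U y‖)
          linarith
      calc _ = C * (japMass * (2 * Real.pi)) * (jap x ^ p * ∫ y, ‖(resMul x)^[n] U y‖ ^ 2) := by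
            ring
        _ ≤ C * (japMass * (2 * Real.pi)) *
            (2 ^ |p| * ∫ y, jap y ^ p * ‖U y‖ ^ 2 * jap (x - y) ^ (-2 : ℝ)) := by gcongr
        _ = _ := by ring

end FrequencySteps

section QuadraticForm

/-- The amplitude of the regularized operator, written in terms of `⟨D⟩^s u`. -/
noncomputable def symAmp (σ s : ℝ) (a : ℝ → ℝ → ℝ) (ε : ℝ) (z : ℝ × ℝ × ℝ) : ℂ :=
  damp σ ε z.1 * ((a z.1 z.2.1 : ℂ) *
    (((jap z.2.1 ^ (-s) : ℝ) : ℂ) * ((jap z.2.2 ^ (-s) : ℝ) : ℂ)))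

lemma jap_rpow_neg_mul_self (s x : ℝ) :
    ((jap x ^ (-s) : ℝ) : ℂ) * ((jap x ^ s : ℝ) : ℂ) = 1 := by
  rw [← ofReal_mul, ← Real.rpow_add (jap_pos x), neg_add_cancel, Real.rpow_zero, ofReal_one]

lemma integral_exp_mul_fourierS (u : 𝓢(ℝ, ℂ)) (x : ℝ) :
    ∫ ξ : ℝ, exp (I * x * ξ) * fourierS u ξ = (2 * Real.pi : ℝ) * u x := by
  have h := FTinv_eq (fourierS u) x
  rw [fourierSInv_fourierS, FTinv, real_smul] at h
  rw [← h, ← mul_assoc, ← ofReal_mul, mul_inv_cancel₀ (by positivity), ofReal_one, one_mul]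

lemma integral_osc_symAmp (σ s : ℝ) (a : ℝ → ℝ → ℝ) (ε x : ℝ) (u : 𝓢(ℝ, ℂ)) :
    ∫ w, osc (symAmp σ s a ε) (japMul s (fourierS u)) (japMul s (fourierS u)) (x, w) =
      (2 * Real.pi : ℝ) ^ 2 * (damp σ ε x * ((((2 * Real.pi)⁻¹ : ℝ) •
        ∫ ξ : ℝ, exp (I * x * ξ) * (a x ξ : ℂ) * fourierS u ξ) * conj (u x))) := by
  have h : ∀ w : ℝ × ℝ,
      osc (symAmp σ s a ε) (japMul s (fourierS u)) (japMul s (fourierS u)) (x, w) =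
        damp σ ε x * ((exp (I * x * w.1) * (a x w.1 : ℂ) * fourierS u w.1) *
          conj (exp (I * x * w.2) * fourierS u w.2)) := fun w => by
    simp only [osc, symAmp, japMul_apply, map_mul, conj_ofReal, ← exp_conj, conj_I]
    rw [show ((x * (w.1 - w.2) : ℝ) : ℂ) * I = I * x * w.1 + -I * x * w.2 by
      push_cast
      ring, exp_add]
    linear_combination (damp σ ε x * (a x w.1 : ℂ) * exp (I * x * w.1) * exp (-I * x * w.2) *
      fourierS u w.1 * conj (fourierS u w.2)) * (((jap w.2 ^ (-s) : ℝ) : ℂ) *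
        ((jap w.2 ^ s : ℝ) : ℂ) * jap_rpow_neg_mul_self s w.1 + jap_rpow_neg_mul_self s w.2)
  simp_rw [h]
  rw [integral_const_mul, Measure.volume_eq_prod, integral_prod_mul (μ := volume) (ν := volume)
    (fun ξ : ℝ => exp (I * x * ξ) * (a x ξ : ℂ) * fourierS u ξ)
    (fun η : ℝ => conj (exp (I * x * η) * fourierS u η)), integral_conj,
    integral_exp_mul_fourierS, map_mul, conj_ofReal, real_smul]
  have h2 : (Real.pi : ℂ) ≠ 0 := by exact_mod_cast Real.pi_ne_zero
  push_cast
  field_simp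

lemma PolyBound.conj_swap {F : ℝ × ℝ × ℝ → ℂ} (h : PolyBound F) :
    PolyBound fun z => conj (F (z.1, z.2.2, z.2.1)) := by
  obtain ⟨C, D, hC, hD, hb⟩ := h
  refine ⟨C, D, hC, hD, fun z => ?_⟩
  rw [RCLike.norm_conj, mul_comm (jap z.2.1)]
  exact hb _

lemma continuous_damp (σ ε : ℝ) : Continuous (damp σ ε) :=
  continuous_iff_continuousAt.2 fun x => (hasDerivAt_damp σ ε x).continuousAt

lemma continuous_ofReal_jap_rpow (s : ℝ) : Continuous fun x : ℝ => ((jap x ^ s : ℝ) : ℂ) :=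
  Complex.continuous_ofReal.comp (continuous_jap_rpow s)

lemma continuous_symAmp {σ s : ℝ} {a : ℝ → ℝ → ℝ}
    (ha : Continuous fun p : ℝ × ℝ => a p.1 p.2) (ε : ℝ) : Continuous (symAmp σ s a ε) := by
  have h1 : Continuous fun z : ℝ × ℝ × ℝ => (a z.1 z.2.1 : ℂ) := Complex.continuous_ofReal.comp
    (ha.comp (by fun_prop : Continuous fun z : ℝ × ℝ × ℝ => (z.1, z.2.1)))
  have h2 := continuous_ofReal_jap_rpow (-s)
  exact ((continuous_damp σ ε).comp continuous_fst).mul (h1.mul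
    ((h2.comp (continuous_fst.comp continuous_snd)).mul
      (h2.comp (continuous_snd.comp continuous_snd))))

lemma polyBound_symAmp {σ s q m C : ℝ} {a : ℝ → ℝ → ℝ} (hC : 0 ≤ C)
    (ha : ∀ x ξ, |a x ξ| ≤ C * jap x ^ q * jap ξ ^ m) (hσ : 0 ≤ σ) (hq : q - σ ≤ -2)
    {ε : ℝ} (hε : ε ∈ Set.Ioc (0 : ℝ) 1) : PolyBound (symAmp σ s a ε) := by
  obtain ⟨C', hC', hb⟩ := (uniformSymbol_damp_decay (ι := Unit) hσ hε).bound
  refine ⟨C' * C, |m| + |s|, by positivity, by positivity, fun z => ?_⟩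
  rw [symAmp, norm_mul, norm_mul, norm_mul, norm_jap_rpow, norm_jap_rpow, norm_real,
    Real.norm_eq_abs]
  have k1 := jap_rpow_pos z.1 q
  have k2 := jap_rpow_pos z.1 (-σ)
  have k3 := jap_rpow_pos z.2.1 m
  have k4 := jap_rpow_pos z.2.1 (-s)
  have k5 := jap_rpow_pos z.2.2 (-s)
  have k6 := jap_rpow_pos z.1 (-2)
  have h1 : jap z.1 ^ (-σ) * jap z.1 ^ q ≤ jap z.1 ^ (-2 : ℝ) := by
    rw [← Real.rpow_add (jap_pos _)]
    exact Real.rpow_le_rpow_of_exponent_le (one_le_jap _) (by linarith)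
  have h2 : jap z.2.1 ^ m * jap z.2.1 ^ (-s) ≤ jap z.2.1 ^ (|m| + |s|) := by
    rw [← Real.rpow_add (jap_pos _)]
    exact Real.rpow_le_rpow_of_exponent_le (one_le_jap _)
      (add_le_add (le_abs_self m) (neg_le_abs s))
  have h3 : jap z.2.2 ^ (-s) ≤ jap z.2.2 ^ (|m| + |s|) :=
    Real.rpow_le_rpow_of_exponent_le (one_le_jap _)
      (by linarith [neg_le_abs s, abs_nonneg m])
  have k7 := jap_rpow_pos z.2.1 (|m| + |s|)
  calc _ ≤ (C' * jap z.1 ^ (-σ)) * ((C * jap z.1 ^ q * jap z.2.1 ^ m) *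
        (jap z.2.1 ^ (-s) * jap z.2.2 ^ (-s))) := by
        have := ha z.1 z.2.1
        have := hb () z.1
        gcongr
    _ = C' * C * ((jap z.1 ^ (-σ) * jap z.1 ^ q) *
        ((jap z.2.1 ^ m * jap z.2.1 ^ (-s)) * jap z.2.2 ^ (-s))) := by ring
    _ ≤ C' * C * (jap z.1 ^ (-2 : ℝ) *
        (jap z.2.1 ^ (|m| + |s|) * jap z.2.2 ^ (|m| + |s|))) := by gcongr
    _ = _ := by rw [Real.mul_rpow (jap_pos _).le (jap_pos _).le]

lemma conj_integral_osc_total {A : ℝ × ℝ × ℝ → ℂ} (hA : Continuous A) (h : PolyBound A)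
    (f : 𝓢(ℝ, ℂ)) : ∫ z, osc (fun z => conj (A (z.1, z.2.2, z.2.1))) f f z =
      conj (∫ z, osc A f f z) := by
  have hA' : Continuous fun z : ℝ × ℝ × ℝ => conj (A (z.1, z.2.2, z.2.1)) :=
    Complex.continuous_conj.comp (hA.comp (by fun_prop))
  have h1 := h.integrable_osc hA f f
  have h2 := h.conj_swap.integrable_osc hA' f f
  rw [Measure.volume_eq_prod] at h1 h2 ⊢
  rw [integral_prod _ h1, integral_prod _ h2, ← integral_conj]
  simp_rw [conj_integral_osc]

lemma osc_symAmp_sub {σ s : ℝ} {a : ℝ → ℝ → ℝ} {b : ℝ × ℝ → ℂ} (hb : Continuous b)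
    (hab : ∀ x ξ, HasDerivAt (fun ξ => (a x ξ : ℂ)) (b (x, ξ)) ξ) (ε : ℝ) (f : ℝ → ℂ)
    (z : ℝ × ℝ × ℝ) :
    osc (symAmp σ s a ε) f f z -
        osc (fun z => conj (symAmp σ s a ε (z.1, z.2.2, z.2.1))) f f z =
      ∫ t in (0 : ℝ)..1,
        osc (fun z => ((z.2.1 - z.2.2 : ℝ) : ℂ) * quotAmp σ s b ε t z) f f z := by
  obtain ⟨x, ξ, η⟩ := z
  have hd : ∀ t : ℝ, HasDerivAt (fun t : ℝ => (a x (η + t * (ξ - η)) : ℂ))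
      (((ξ - η : ℝ) : ℂ) * b (x, η + t * (ξ - η))) t := fun t => by
    have h0 : HasDerivAt (fun t : ℝ => η + t * (ξ - η)) (ξ - η) t := by
      simpa using ((hasDerivAt_id t).mul_const (ξ - η)).const_add η
    exact ((hab x _).scomp t h0).congr_deriv (real_smul)
  have hc : Continuous fun t : ℝ => ((ξ - η : ℝ) : ℂ) * b (x, η + t * (ξ - η)) := by fun_prop
  have h1 := intervalIntegral.integral_eq_sub_of_hasDerivAt (fun t _ => hd t)
    (hc.intervalIntegrable 0 1)
  rw [one_mul, zero_mul, add_zero, add_sub_cancel] at h1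
  have h2 : ∀ t : ℝ,
      osc (fun z => ((z.2.1 - z.2.2 : ℝ) : ℂ) * quotAmp σ s b ε t z) f f (x, ξ, η) =
        (((ξ - η : ℝ) : ℂ) * b (x, η + t * (ξ - η))) * (damp σ ε x *
          (((jap ξ ^ (-s) : ℝ) : ℂ) * ((jap η ^ (-s) : ℝ) : ℂ)) *
          (exp ((x * (ξ - η) : ℝ) * I) * (f ξ * conj (f η)))) := fun t => by
    simp only [osc, quotAmp]
    ring
  simp_rw [h2]
  rw [intervalIntegral.integral_mul_const, h1]
  simp only [osc, symAmp, damp, map_mul, conj_ofReal]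
  ring

lemma integral_osc_quotAmp_swap {q s σ : ℝ} {b : ℝ × ℝ → ℂ} (hσ : 0 ≤ σ) (hq : q - σ ≤ -2)
    (hb : UniformSymbol (fun z => jap z.1 ^ q * jap z.2 ^ (2 * s)) fun _ : Unit => b)
    {ε : ℝ} (hε : ε ∈ Set.Ioc (0 : ℝ) 1) (f : 𝓢(ℝ, ℂ)) :
    ∫ z, ∫ t in (0 : ℝ)..1,
        osc (fun z => ((z.2.1 - z.2.2 : ℝ) : ℂ) * quotAmp σ s b ε t z) f f z =
      ∫ t in (0 : ℝ)..1, ∫ z,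
        osc (fun z => ((z.2.1 - z.2.2 : ℝ) : ℂ) * quotAmp σ s b ε t z) f f z := by
  simp_rw [intervalIntegral.integral_of_le zero_le_one]
  refine integral_integral_swap ?_
  have hbc := (hb.1 ()).continuous
  have hf := f.continuous
  have hdamp := continuous_damp σ ε
  have hk := continuous_ofReal_jap_rpow (-s)
  have hcont : Continuous (Function.uncurry fun (z : ℝ × ℝ × ℝ) (t : ℝ) =>
      osc (fun z => ((z.2.1 - z.2.2 : ℝ) : ℂ) * quotAmp σ s b ε t z) f f z) := by
    have h1 : Continuous fun w : (ℝ × ℝ × ℝ) × ℝ => conj (f w.1.2.2) :=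
      Complex.continuous_conj.comp (by fun_prop)
    have h2 : Continuous fun w : (ℝ × ℝ × ℝ) × ℝ => ((jap w.1.2.1 ^ (-s) : ℝ) : ℂ) :=
      hk.comp (by fun_prop : Continuous fun w : (ℝ × ℝ × ℝ) × ℝ => w.1.2.1)
    have h3 : Continuous fun w : (ℝ × ℝ × ℝ) × ℝ => ((jap w.1.2.2 ^ (-s) : ℝ) : ℂ) :=
      hk.comp (by fun_prop : Continuous fun w : (ℝ × ℝ × ℝ) × ℝ => w.1.2.2)
    have h4 := h2.mul h3
    unfold Function.uncurry osc quotAmp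
    fun_prop
  obtain ⟨C, D, hC, hD, hB⟩ := (uniformSymbol_quotAmp hσ hq hb hε).exists_polyBound
  have hdom : Integrable (fun w : (ℝ × ℝ × ℝ) × ℝ => oscBound (2 * C) (1 + D) f f w.1)
      (volume.prod (volume.restrict (Set.Ioc 0 1))) :=
    (integrable_oscBound (2 * C) (1 + D) f f).comp_fst _
  refine hdom.mono' hcont.aestronglyMeasurable ?_
  rw [← Measure.restrict_univ (μ := (volume : Measure (ℝ × ℝ × ℝ))), Measure.prod_restrict]
  refine ae_restrict_of_forall_mem (MeasurableSet.univ.prod measurableSet_Ioc) fun w hw => ?_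
  have ht : w.2 ∈ Set.Icc (0 : ℝ) 1 := ⟨hw.2.1.le, hw.2.2⟩
  refine norm_osc_le (F := fun z => ((z.2.1 - z.2.2 : ℝ) : ℂ) * quotAmp σ s b ε w.2 z)
    (fun z => ?_) f f w.1
  rw [norm_mul, norm_real, Real.norm_eq_abs]
  have h1 : 0 < jap z.2.1 * jap z.2.2 := mul_pos (jap_pos _) (jap_pos _)
  have h2 : |z.2.1 - z.2.2| ≤ 2 * (jap z.2.1 * jap z.2.2) := by
    refine (abs_le_jap _).trans ?_
    simpa [sub_eq_add_neg, jap_neg] using jap_add_le z.2.1 (-z.2.2)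
  rw [Real.rpow_add h1, Real.rpow_one]
  calc _ ≤ (2 * (jap z.2.1 * jap z.2.2)) *
      (C * (jap z.1 ^ (-2 : ℝ) * (jap z.2.1 * jap z.2.2) ^ D)) :=
        mul_le_mul h2 (hB ⟨w.2, ht⟩ z) (norm_nonneg _) (by positivity)
    _ = _ := by ring

lemma norm_integral_osc_quotAmp {q s σ : ℝ} {b c : ℝ × ℝ → ℂ} (hσ : 0 ≤ σ) (hq : q - σ ≤ -2)
    (hb : UniformSymbol (fun z => jap z.1 ^ q * jap z.2 ^ (2 * s)) fun _ : Unit => b)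
    (hc : UniformSymbol (fun z => jap z.1 ^ (q - 1) * jap z.2 ^ (2 * s)) fun _ : Unit => c)
    (hbc : ∀ x ξ, HasDerivAt (fun x => b (x, ξ)) (c (x, ξ)) x)
    (i : Set.Ioc (0 : ℝ) 1 × Set.Icc (0 : ℝ) 1) (f : 𝓢(ℝ, ℂ)) :
    ‖∫ z, osc (fun z => ((z.2.1 - z.2.2 : ℝ) : ℂ) * quotAmp σ s b i.1 i.2 z) f f z‖ =
      ‖∫ z, osc (gainAmp σ s b c i.1 i.2) f f z‖ := by
  have hF := (uniformSymbol_quotAmp hσ hq hb i.1.2).reindex fun _ : Unit => i.2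
  have hF' := (isAmplitude_gainAmp hσ hq hb hc).2 i
  have hFc := (hF.1 ()).continuous
  have hFc' := (hF'.1 ()).continuous
  have key := integral_osc_deriv hFc hFc' hF.polyBound hF'.polyBound
    (fun x w => hasDerivAt_quotAmp hbc i.1 i.2 x w) f f
  have h1 := hF'.polyBound.integrable_osc hFc' f f
  have h2 := hF.polyBound.freq_mul.integrable_osc (by fun_prop) f f
  have h3 : ∀ z, osc (fun z => gainAmp σ s b c i.1 i.2 z +
      I * ((z.2.1 - z.2.2 : ℝ) : ℂ) * quotAmp σ s b i.1 i.2 z) f f z =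
      osc (gainAmp σ s b c i.1 i.2) f f z +
        osc (fun z => I * ((z.2.1 - z.2.2 : ℝ) : ℂ) * quotAmp σ s b i.1 i.2 z) f f z :=
    fun z => by
      simp only [osc]
      ring
  have h4 : ∀ z, osc (fun z => I * ((z.2.1 - z.2.2 : ℝ) : ℂ) * quotAmp σ s b i.1 i.2 z) f f z =
      I * osc (fun z => ((z.2.1 - z.2.2 : ℝ) : ℂ) * quotAmp σ s b i.1 i.2 z) f f z :=
    fun z => by
      simp only [osc]
      ring
  simp_rw [h3] at key
  rw [integral_add h1 h2] at key
  simp_rw [h4] at key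
  rw [integral_const_mul] at key
  rw [eq_neg_of_add_eq_zero_left key, norm_neg, norm_mul, norm_I, one_mul]

/-- Uniform estimate for the imaginary part of the regularized quadratic form. -/
lemma exists_abs_im_regularized_le {m q σ C₀ : ℝ} {a : ℝ → ℝ → ℝ} {b c : ℝ × ℝ → ℂ}
    (hac : Continuous fun p : ℝ × ℝ => a p.1 p.2) (hC₀ : 0 ≤ C₀)
    (ha : ∀ x ξ, |a x ξ| ≤ C₀ * jap x ^ q * jap ξ ^ m) (hσ : 0 ≤ σ) (hq : q - σ ≤ -2)
    (hb : UniformSymbol (fun z => jap z.1 ^ q * jap z.2 ^ (m - 1)) fun _ : Unit => b)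
    (hc : UniformSymbol (fun z => jap z.1 ^ (q - 1) * jap z.2 ^ (m - 1)) fun _ : Unit => c)
    (hab : ∀ x ξ, HasDerivAt (fun ξ => (a x ξ : ℂ)) (b (x, ξ)) ξ)
    (hbc : ∀ x ξ, HasDerivAt (fun x => b (x, ξ)) (c (x, ξ)) x) :
    ∃ C, 0 ≤ C ∧ ∀ ε ∈ Set.Ioc (0 : ℝ) 1, ∀ u : 𝓢(ℝ, ℂ),
      |(∫ x : ℝ, damp σ ε x * ((((2 * Real.pi)⁻¹ : ℝ) •
        ∫ ξ : ℝ, exp (I * x * ξ) * (a x ξ : ℂ) * fourierS u ξ) * conj (u x))).im| ≤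
      C * ∫ x, jap x ^ (q - 1) *
        ‖fourierSInv (japMul ((m - 1) / 2) (fourierS u)) x‖ ^ 2 := by
  obtain ⟨s, hs⟩ : ∃ s, s = (m - 1) / 2 := ⟨_, rfl⟩
  have hs' : m - 1 = 2 * s := by rw [hs]; ring
  rw [hs'] at hb hc
  rw [← hs]
  obtain ⟨C, hC, hbound⟩ := (isAmplitude_gainAmp hσ hq hb hc).exists_norm_integral_osc_le
  refine ⟨C, hC, fun ε hε u => ?_⟩
  set R := ∫ x, jap x ^ (q - 1) * ‖fourierSInv (japMul s (fourierS u)) x‖ ^ 2 with hR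
  set Q := ∫ x : ℝ, damp σ ε x * ((((2 * Real.pi)⁻¹ : ℝ) •
    ∫ ξ : ℝ, exp (I * x * ξ) * (a x ξ : ℂ) * fourierS u ξ) * conj (u x)) with hQ
  set φ := japMul s (fourierS u) with hφ
  have hA := continuous_symAmp (σ := σ) (s := s) hac ε
  have hpA := polyBound_symAmp (s := s) hC₀ ha hσ hq hε
  have hA' : Continuous fun z : ℝ × ℝ × ℝ => conj (symAmp σ s a ε (z.1, z.2.2, z.2.1)) :=
    Complex.continuous_conj.comp (hA.comp (by fun_prop))
  have i1 := hpA.integrable_osc hA φ φ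
  have i2 := hpA.conj_swap.integrable_osc hA' φ φ
  have hX : ∫ z, osc (symAmp σ s a ε) φ φ z = ((2 * Real.pi : ℝ) : ℂ) ^ 2 * Q := by
    rw [Measure.volume_eq_prod] at i1 ⊢
    rw [integral_prod _ i1, hQ, ← integral_const_mul]
    simp_rw [hφ, integral_osc_symAmp]
  have hdiff : (∫ z, osc (symAmp σ s a ε) φ φ z) - conj (∫ z, osc (symAmp σ s a ε) φ φ z) =
      ∫ t in (0 : ℝ)..1, ∫ z,
        osc (fun z => ((z.2.1 - z.2.2 : ℝ) : ℂ) * quotAmp σ s b ε t z) φ φ z := by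
    rw [← conj_integral_osc_total hA hpA, ← integral_sub i1 i2,
      ← integral_osc_quotAmp_swap hσ hq hb hε]
    simp_rw [osc_symAmp_sub (hb.1 ()).continuous hab]
  have hle : ‖∫ t in (0 : ℝ)..1, ∫ z,
      osc (fun z => ((z.2.1 - z.2.2 : ℝ) : ℂ) * quotAmp σ s b ε t z) φ φ z‖ ≤ C * R := by
    have h := intervalIntegral.norm_integral_le_of_norm_le_const (a := (0 : ℝ)) (b := 1)
      (C := C * R) (f := fun t => ∫ z,
        osc (fun z => ((z.2.1 - z.2.2 : ℝ) : ℂ) * quotAmp σ s b ε t z) φ φ z) fun t ht => ?_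
    · simpa using h
    · rw [Set.uIoc_of_le zero_le_one] at ht
      have h1 := norm_integral_osc_quotAmp hσ hq hb hc hbc (⟨ε, hε⟩, ⟨t, ht.1.le, ht.2⟩) φ
      have h2 := hbound (⟨ε, hε⟩, ⟨t, ht.1.le, ht.2⟩) (fourierSInv φ)
      rw [fourierS_fourierSInv] at h2
      exact h1.le.trans h2
  rw [← hdiff, hX, sub_conj, norm_mul, norm_I, mul_one, norm_real, Real.norm_eq_abs,
    ← ofReal_pow, im_ofReal_mul, abs_mul, abs_mul, abs_two, abs_of_pos (by positivity)] at hle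
  have hpi : 1 ≤ (2 * Real.pi) ^ 2 := one_le_pow₀ (by linarith [Real.pi_gt_three])
  nlinarith [abs_nonneg Q.im]

lemma norm_integral_form_le {m q C₀ : ℝ} {a : ℝ → ℝ → ℝ}
    (ha : ∀ x ξ, |a x ξ| ≤ C₀ * jap x ^ q * jap ξ ^ m) (v : 𝓢(ℝ, ℂ)) (x : ℝ) :
    ‖∫ ξ : ℝ, exp (I * x * ξ) * (a x ξ : ℂ) * v ξ‖ ≤
      C₀ * jap x ^ q * ∫ ξ, ‖japMul m v ξ‖ := by
  rw [← integral_const_mul]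
  refine norm_integral_le_of_norm_le ((japMul m v).integrable.norm.const_mul (C₀ * jap x ^ q))
    (Filter.Eventually.of_forall fun ξ => ?_)
  rw [norm_mul, norm_mul, norm_japMul, norm_real, Real.norm_eq_abs,
    show I * (x : ℂ) * ξ = ((x * ξ : ℝ) : ℂ) * I by
      push_cast
      ring, norm_exp_ofReal_mul_I, one_mul]
  calc _ ≤ C₀ * jap x ^ q * jap ξ ^ m * ‖v ξ‖ :=
        mul_le_mul_of_nonneg_right (ha x ξ) (norm_nonneg _)
    _ = _ := by ring

lemma stronglyMeasurable_integral_form {a : ℝ → ℝ → ℝ}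
    (hac : Continuous fun p : ℝ × ℝ => a p.1 p.2) (v : 𝓢(ℝ, ℂ)) :
    StronglyMeasurable fun x : ℝ => ∫ ξ : ℝ, exp (I * x * ξ) * (a x ξ : ℂ) * v ξ := by
  have hv := v.continuous
  refine StronglyMeasurable.integral_prod_right (Continuous.stronglyMeasurable ?_)
  unfold Function.uncurry
  fun_prop

lemma integrable_form {m q C₀ : ℝ} {a : ℝ → ℝ → ℝ}
    (hac : Continuous fun p : ℝ × ℝ => a p.1 p.2)
    (ha : ∀ x ξ, |a x ξ| ≤ C₀ * jap x ^ q * jap ξ ^ m) (u v : 𝓢(ℝ, ℂ)) :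
    Integrable fun x : ℝ => (((2 * Real.pi)⁻¹ : ℝ) •
      ∫ ξ : ℝ, exp (I * x * ξ) * (a x ξ : ℂ) * v ξ) * conj (u x) := by
  have hm := stronglyMeasurable_integral_form hac v
  have hcu : Continuous fun x => conj (u x) := Complex.continuous_conj.comp u.continuous
  have hbd := ((japMul q u).integrable (μ := volume)).norm.const_mul
    ((2 * Real.pi)⁻¹ * (C₀ * ∫ ξ, ‖japMul m v ξ‖))
  have hmeas := ((hm.const_smul ((2 * Real.pi)⁻¹ : ℝ)).mul
    hcu.stronglyMeasurable).aestronglyMeasurable (μ := volume)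
  refine Integrable.mono' hbd hmeas (Filter.Eventually.of_forall fun x => ?_)
  have h := norm_integral_form_le ha v x
  rw [norm_mul, RCLike.norm_conj, norm_smul, Real.norm_of_nonneg (by positivity), norm_japMul]
  calc _ ≤ (2 * Real.pi)⁻¹ * (C₀ * jap x ^ q * ∫ ξ, ‖japMul m v ξ‖) * ‖u x‖ := by
        gcongr
    _ = _ := by ring

lemma tendsto_regularized_integral {σ : ℝ} (hσ : 0 ≤ σ) {g : ℝ → ℂ} (hg : Integrable g) :
    Filter.Tendsto (fun n : ℕ => ∫ x, damp σ (1 / ((n : ℝ) + 1)) x * g x) Filter.atTop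
      (nhds (∫ x, g x)) := by
  refine tendsto_integral_of_dominated_convergence (fun x => ‖g x‖)
    (fun n => (continuous_damp _ _).aestronglyMeasurable.mul hg.aestronglyMeasurable) hg.norm
    (fun n => Filter.Eventually.of_forall fun x => ?_) (Filter.Eventually.of_forall fun x => ?_)
  · rw [norm_mul]
    exact mul_le_of_le_one_left (norm_nonneg _) (norm_damp_le_one hσ _ _)
  · have hc : Continuous fun ε : ℝ => damp σ ε x * g x := by
      have h : Continuous fun ε : ℝ => jap (ε * x) ^ (-σ) :=
        (continuous_jap_rpow (-σ)).comp (by fun_prop : Continuous fun ε : ℝ => ε * x)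
      unfold damp
      fun_prop
    have h0 := (hc.tendsto 0).comp (tendsto_one_div_add_atTop_nhds_zero_nat (𝕜 := ℝ))
    simpa [damp, jap, Function.comp_def] using h0

end QuadraticForm

/-- Claim 4.3: for a real-valued symbol `a ∈ S^{m,q}`, the imaginary part of the
quadratic form of `a(x,D)` gains one order: `|Im (a(x,D)u|u)| ≤ C‖⟨x⟩^{(q-1)/2}⟨D⟩^{(m-1)/2}u‖²`. -/
theorem stmt_13 (m q : ℝ) (a : ℝ → ℝ → ℝ)
    (ha_smooth : ContDiff ℝ (⊤ : ℕ∞) (fun p : ℝ × ℝ => a p.1 p.2))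
    (ha : ∀ k β : ℕ, ∃ C : ℝ, 0 < C ∧ ∀ x ξ : ℝ,
      |iteratedDeriv k (fun x' : ℝ => iteratedDeriv β (fun ξ' : ℝ => a x' ξ') ξ) x|
        ≤ C * jap x ^ (q - (k : ℝ)) * jap ξ ^ (m - (β : ℝ))) :
    ∃ C : ℝ, 0 < C ∧ ∀ u : SchwartzMap ℝ ℂ,
      |(∫ x : ℝ, (((2 * Real.pi)⁻¹ : ℝ) •
            ∫ ξ : ℝ, Complex.exp (Complex.I * (x : ℂ) * (ξ : ℂ)) * ((a x ξ : ℝ) : ℂ)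
              * FT (fun y => u y) ξ) * conj (u x)).im|
        ≤ C * ∫ x : ℝ, jap x ^ (q - 1)
            * ‖FTinv (fun ξ => ((jap ξ ^ ((m - 1) / 2) : ℝ) : ℂ) * FT (fun y => u y) ξ) x‖ ^ 2 := by
  obtain ⟨C₀, hC₀, h0⟩ := ha 0 0
  simp only [iteratedDeriv_zero, Nat.cast_zero, sub_zero] at h0
  obtain ⟨b, c, hb, hc, hab, hbc⟩ := exists_symbol_derivatives (ι := Unit) ha_smooth ha
  have hσ : 0 ≤ |q| + 2 := by positivity
  have hac := ha_smooth.continuous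
  obtain ⟨C, hC, hbound⟩ := exists_abs_im_regularized_le hac hC₀.le h0 hσ
    (by linarith [le_abs_self q]) hb hc hab hbc
  refine ⟨C + 1, by positivity, fun u => ?_⟩
  have hR : ∀ x, FTinv (fun ξ => ((jap ξ ^ ((m - 1) / 2) : ℝ) : ℂ) * FT (fun y => u y) ξ) x =
      fourierSInv (japMul ((m - 1) / 2) (fourierS u)) x := fun x => by
    rw [← FTinv_eq]
    simp only [japMul_apply, fourierS_apply]
  simp_rw [hR, ← fourierS_apply]
  have hR0 : 0 ≤ ∫ x, jap x ^ (q - 1) *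
      ‖fourierSInv (japMul ((m - 1) / 2) (fourierS u)) x‖ ^ 2 :=
    integral_nonneg fun x => mul_nonneg (jap_rpow_pos x _).le (by positivity)
  have hlim := tendsto_regularized_integral hσ (integrable_form hac h0 u (fourierS u))
  have hle := le_of_tendsto ((continuous_abs.comp Complex.continuous_im).tendsto _ |>.comp hlim)
    (Filter.Eventually.of_forall fun n : ℕ => hbound (1 / ((n : ℝ) + 1))
      ⟨by positivity, (div_le_one (by positivity)).2 (by linarith [Nat.cast_nonneg (α := ℝ) n])⟩ u)
  exact hle.trans (mul_le_mul_of_nonneg_right (by linarith) hR0)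
end

section
/- Let 1 ≤ α ≤ 2 and let K: ℝ → ℝ be the function whose Fourier transform is ξ ↦ e^{−|ξ|^α}. Then K is real-valued, even, strictly positive on ℝ, and K'(x) < 0 for all x > 0. -/
open MeasureTheory Complex ComplexConjugate

section

open Filter Topology Set Real

/-- `f` is given on `[0, 1)` by a power series with nonnegative coefficients. -/
def HasNonnegSeries (f : ℝ → ℝ) : Prop :=
  ∃ b : ℕ → ℝ, (∀ k, 0 ≤ b k) ∧ ∀ z ∈ Ico (0 : ℝ) 1, HasSum (fun k => b k * z ^ k) (f z)

theorem HasNonnegSeries.mul {f g : ℝ → ℝ} (hf : HasNonnegSeries f) (hg : HasNonnegSeries g) :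
    HasNonnegSeries (fun z => f z * g z) := by
  obtain ⟨a, ha, hfa⟩ := hf
  obtain ⟨b, hb, hgb⟩ := hg
  refine ⟨fun k => ∑ p ∈ Finset.HasAntidiagonal.antidiagonal k, a p.1 * b p.2,
    fun k => Finset.sum_nonneg fun p _ => mul_nonneg (ha _) (hb _), fun z hz => ?_⟩
  have h1 := (hfa z hz).summable.norm
  have h2 := (hgb z hz).summable.norm
  have h3 := tsum_mul_tsum_eq_tsum_sum_antidiagonal_of_summable_norm h1 h2
  have h4 := (summable_norm_sum_mul_antidiagonal_of_summable_norm h1 h2).of_norm.hasSum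
  rw [← h3, (hfa z hz).tsum_eq, (hgb z hz).tsum_eq] at h4
  refine h4.congr_fun fun k => ?_
  rw [Finset.sum_mul]
  refine Finset.sum_congr rfl fun p hp => ?_
  rw [← Finset.HasAntidiagonal.mem_antidiagonal.1 hp, pow_add]
  ring

theorem HasNonnegSeries.pow {f : ℝ → ℝ} (hf : HasNonnegSeries f) (n : ℕ) :
    HasNonnegSeries (fun z => f z ^ n) := by
  induction n with
  | zero =>
    refine ⟨fun k => if k = 0 then 1 else 0, fun k => by dsimp only; split_ifs <;> norm_num, fun z _ => ?_⟩
    simp only [pow_zero]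
    convert hasSum_ite_eq (0 : ℕ) (1 : ℝ) using 2 with k
    split_ifs with h <;> simp [h]
  | succ n ih => simpa only [pow_succ] using ih.mul hf

theorem Ring.choose_succ_mul (β : ℝ) (k : ℕ) :
    Ring.choose β (k + 1) * (k + 1) = Ring.choose β k * (β - k) := by
  have h : (descPochhammer ℤ (k + 1)).smeval β = (descPochhammer ℤ k).smeval β * (β - k) := by
    rw [descPochhammer_succ_right, Polynomial.smeval_mul, Polynomial.smeval_sub,
      Polynomial.smeval_X, Polynomial.smeval_natCast]
    simp
  rw [Ring.choose_eq_smul, Ring.choose_eq_smul, h, Nat.factorial_succ]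
  have : (k.factorial : ℝ) ≠ 0 := by positivity
  simp only [smul_eq_mul]
  push_cast
  field_simp

theorem neg_one_pow_mul_choose_succ_nonneg {β : ℝ} (h0 : 0 ≤ β) (h1 : β ≤ 1) (k : ℕ) :
    0 ≤ (-1) ^ k * Ring.choose β (k + 1) := by
  induction k with
  | zero => simpa using h0
  | succ k ih =>
    have h := Ring.choose_succ_mul β (k + 1)
    push_cast at h
    have hk : (0 : ℝ) ≤ k := k.cast_nonneg
    refine nonneg_of_mul_nonneg_left (b := (k : ℝ) + 1 + 1) ?_ (by positivity)
    rw [mul_assoc, h]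
    have := mul_nonneg ih (show 0 ≤ k + 1 - β by linarith)
    convert this using 1
    ring

theorem hasNonnegSeries_one_sub_one_sub_rpow {β : ℝ} (h0 : 0 ≤ β) (h1 : β ≤ 1) :
    HasNonnegSeries (fun z => 1 - (1 - z) ^ β) := by
  refine ⟨fun k => (if k = 0 then 1 else 0) - (-1) ^ k * Ring.choose β k, fun k => ?_,
    fun z hz => ?_⟩
  · cases k with
    | zero => simp
    | succ k =>
      have := neg_one_pow_mul_choose_succ_nonneg h0 h1 k
      simp only [Nat.add_eq_zero_iff, one_ne_zero, and_false, if_false, pow_succ]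
      linarith
  · have h := (Real.one_add_rpow_hasFPowerSeriesOnBall_zero (a := β)).hasSum (y := -z)
      (by simpa [enorm_lt_coe, ← ofReal_norm, abs_of_nonneg hz.1] using hz.2)
    simp only [binomialSeries_apply, List.ofFn_const, List.prod_replicate, smul_eq_mul,
      ← sub_eq_add_neg] at h
    rw [show 1 + (0 - z) = 1 - z by ring] at h
    refine ((hasSum_ite_eq (0 : ℕ) (1 : ℝ)).sub h).congr_fun fun k => ?_
    rw [neg_pow]
    split_ifs with hk <;> simp [hk] ; ring

/-- The total mass of a nonnegative power series bounded by `1` on `[0, 1)` is at most `1`. -/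
theorem summable_and_tsum_le_one_of_hasSum {b : ℕ → ℝ} {f : ℝ → ℝ} (hb : ∀ k, 0 ≤ b k)
    (hf : ∀ z ∈ Ico (0 : ℝ) 1, HasSum (fun k => b k * z ^ k) (f z))
    (h1 : ∀ z ∈ Ico (0 : ℝ) 1, f z ≤ 1) : Summable b ∧ ∑' k, b k ≤ 1 := by
  have key : ∀ u : Finset ℕ, ∑ k ∈ u, b k ≤ 1 := by
    intro u
    have hc : Tendsto (fun z : ℝ => ∑ k ∈ u, b k * z ^ k) (𝓝[<] 1) (𝓝 (∑ k ∈ u, b k * 1 ^ k)) := by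
      refine (Continuous.tendsto (by fun_prop) 1).mono_left nhdsWithin_le_nhds
    simp only [one_pow, mul_one] at hc
    refine le_of_tendsto hc ?_
    filter_upwards [Ico_mem_nhdsLT (show (0 : ℝ) < 1 by norm_num)] with z hz
    exact (sum_le_hasSum u (fun k _ => mul_nonneg (hb k) (pow_nonneg hz.1 k)) (hf z hz)).trans
      (h1 z hz)
  exact ⟨summable_of_sum_le hb key, Real.tsum_le_of_sum_range_le hb fun n => key _⟩

theorem one_sub_one_sub_exp_neg_rpow_nonneg {β τ : ℝ} (hβ : 0 ≤ β) (hτ : 0 ≤ τ) :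
    0 ≤ 1 - (1 - Real.exp (-τ)) ^ β := by
  have h1 : Real.exp (-τ) ≤ 1 := Real.exp_le_one_iff.2 (by linarith)
  have := Real.rpow_le_one (sub_nonneg.2 h1) (by linarith [Real.exp_pos (-τ)]) hβ
  linarith

theorem one_sub_one_sub_exp_neg_rpow_le {β τ : ℝ} (hβ0 : 0 < β) (hβ1 : β ≤ 1) (hτ : 0 ≤ τ) :
    1 - (1 - Real.exp (-τ)) ^ β ≤ Real.exp (-(τ ^ β / 2)) := by
  have h1 : Real.exp (-τ) ≤ 1 := Real.exp_le_one_iff.2 (by linarith)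
  rcases le_total τ 1 with h | h
  · have h2 : τ / 2 ≤ 1 - Real.exp (-τ) := by
      have h3 := Real.add_one_le_exp τ
      have h4 : Real.exp (-τ) ≤ (τ + 1)⁻¹ := by
        rw [Real.exp_neg]
        exact inv_anti₀ (by linarith) h3
      have h5 : (τ + 1)⁻¹ ≤ 1 - τ / 2 := by
        rw [inv_le_iff_one_le_mul₀ (by linarith)]
        nlinarith
      linarith
    have h3 : τ ^ β / 2 ≤ (τ / 2) ^ β := by
      rw [Real.div_rpow hτ (by norm_num)]
      have : (2 : ℝ) ^ β ≤ 2 := by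
        simpa using Real.rpow_le_rpow_of_exponent_le (show (1 : ℝ) ≤ 2 by norm_num) hβ1
      gcongr
    have h4 := Real.rpow_le_rpow (by linarith) h2 hβ0.le
    have h5 := Real.one_sub_le_exp_neg (τ ^ β / 2)
    linarith
  · have h2 := Real.self_le_rpow_of_le_one (sub_nonneg.2 h1) (by linarith [Real.exp_pos (-τ)]) hβ1
    have h3 : τ ^ β ≤ τ := by simpa using Real.rpow_le_rpow_of_exponent_le h hβ1
    have h4 : Real.exp (-τ) ≤ Real.exp (-(τ ^ β / 2)) := Real.exp_le_exp.2 (by linarith)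
    linarith

theorem natCast_mul_rpow_neg_inv {β : ℝ} (hβ : 0 < β) {n : ℕ} (hn : n ≠ 0) :
    n * ((n : ℝ) ^ (-β⁻¹)) ^ β = 1 := by
  have hn' : (n : ℝ) ≠ 0 := by exact_mod_cast hn
  rw [← Real.rpow_mul n.cast_nonneg, neg_mul, inv_mul_cancel₀ hβ.ne', Real.rpow_neg_one,
    mul_inv_cancel₀ hn']

/-- The Laplace transform at `l` of the normalized sum of `n` independent Sibuya variables. -/
noncomputable def stableApprox (β : ℝ) (n : ℕ) (l : ℝ) : ℝ :=
  (1 - (1 - Real.exp (-(l * (n : ℝ) ^ (-β⁻¹)))) ^ β) ^ n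

theorem stableApprox_nonneg {β : ℝ} (hβ : 0 ≤ β) (n : ℕ) {l : ℝ} (hl : 0 ≤ l) :
    0 ≤ stableApprox β n l :=
  pow_nonneg (one_sub_one_sub_exp_neg_rpow_nonneg hβ (by positivity)) n

theorem stableApprox_le {β : ℝ} (hβ0 : 0 < β) (hβ1 : β ≤ 1) {n : ℕ} (hn : n ≠ 0) {l : ℝ}
    (hl : 0 ≤ l) : stableApprox β n l ≤ Real.exp (-(l ^ β / 2)) := by
  have hs : 0 ≤ (n : ℝ) ^ (-β⁻¹) := by positivity
  calc stableApprox β n l ≤ Real.exp (-((l * (n : ℝ) ^ (-β⁻¹)) ^ β / 2)) ^ n :=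
        pow_le_pow_left₀ (one_sub_one_sub_exp_neg_rpow_nonneg hβ0.le (by positivity))
          (one_sub_one_sub_exp_neg_rpow_le hβ0 hβ1 (by positivity)) n
    _ = Real.exp (-(l ^ β / 2)) := by
        rw [← Real.exp_nat_mul, Real.mul_rpow hl hs]
        congr 1
        linear_combination (-l ^ β / 2) * natCast_mul_rpow_neg_inv hβ0 hn

theorem tendsto_stableApprox {β : ℝ} (hβ : 0 < β) {l : ℝ} (hl : 0 < l) :
    Tendsto (fun n => stableApprox β n l) atTop (𝓝 (Real.exp (-(l ^ β)))) := by
  have hs : Tendsto (fun n : ℕ => (n : ℝ) ^ (-β⁻¹)) atTop (𝓝[>] 0) := by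
    refine tendsto_nhdsWithin_iff.2 ⟨(tendsto_rpow_neg_atTop (inv_pos.2 hβ)).comp
      tendsto_natCast_atTop_atTop, ?_⟩
    filter_upwards [eventually_gt_atTop 0] with n hn
    exact Real.rpow_pos_of_pos (by exact_mod_cast hn) _
  have hd : HasDerivAt (fun s : ℝ => 1 - Real.exp (-(l * s))) l 0 := by
    have := ((((hasDerivAt_id (0 : ℝ)).const_mul l).neg).exp).const_sub 1
    simpa using this
  have hq : Tendsto (fun s : ℝ => (1 - Real.exp (-(l * s))) / s) (𝓝[>] 0) (𝓝 l) := by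
    have := (hasDerivAt_iff_tendsto_slope_zero.1 hd).mono_left
      (nhdsWithin_mono 0 fun x (hx : 0 < x) => hx.ne')
    refine this.congr fun s => ?_
    simp [div_eq_inv_mul]
  have hr := (hq.comp hs).rpow_const (p := β) (Or.inl hl.ne')
  have key : Tendsto (fun n : ℕ => (n : ℝ) * (-(1 - Real.exp (-(l * (n : ℝ) ^ (-β⁻¹)))) ^ β)) atTop
      (𝓝 (-(l ^ β))) := by
    refine hr.neg.congr' ?_
    filter_upwards [eventually_ne_atTop 0] with n hn
    have h1 := natCast_mul_rpow_neg_inv hβ hn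
    have hs0 : 0 < (n : ℝ) ^ (-β⁻¹) :=
      Real.rpow_pos_of_pos (by exact_mod_cast Nat.pos_of_ne_zero hn) _
    have h2 : 0 ≤ 1 - Real.exp (-(l * (n : ℝ) ^ (-β⁻¹))) :=
      sub_nonneg.2 (Real.exp_le_one_iff.2 (by nlinarith))
    simp only [Function.comp_apply]
    rw [Real.div_rpow h2 hs0.le, eq_inv_of_mul_eq_one_right h1, div_inv_eq_mul]
    ring
  refine (Real.tendsto_one_add_pow_exp_of_tendsto key).congr fun n => ?_
  rw [stableApprox, sub_eq_add_neg (1 : ℝ) (_ ^ β)]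

theorem exists_hasSum_stableApprox {β : ℝ} (hβ0 : 0 < β) (hβ1 : β ≤ 1) {n : ℕ} (hn : n ≠ 0) :
    ∃ b : ℕ → ℝ, (∀ k, 0 ≤ b k) ∧ b 0 = 0 ∧ Summable b ∧ ∑' k, b k ≤ 1 ∧
      ∀ l, 0 < l → HasSum (fun k : ℕ => b k * Real.exp (-(k * (n : ℝ) ^ (-β⁻¹)) * l))
        (stableApprox β n l) := by
  obtain ⟨b, hb, hs⟩ := (hasNonnegSeries_one_sub_one_sub_rpow hβ0.le hβ1).pow n
  have hle : ∀ z ∈ Ico (0 : ℝ) 1, (1 - (1 - z) ^ β) ^ n ≤ 1 := by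
    intro z hz
    have h1 := Real.rpow_le_one (sub_nonneg.2 hz.2.le) (by linarith [hz.1]) hβ0.le
    have h2 := Real.rpow_nonneg (sub_nonneg.2 hz.2.le) β
    exact pow_le_one₀ (by linarith) (by linarith)
  obtain ⟨hsum, htsum⟩ := summable_and_tsum_le_one_of_hasSum hb hs hle
  refine ⟨b, hb, ?_, hsum, htsum, fun l hl => ?_⟩
  · have h1 := hs 0 (by simp)
    have h2 := hasSum_single (f := fun k => b k * (0 : ℝ) ^ k) 0 (fun k hk => by simp [hk])
    have := h1.unique h2
    simpa [hn] using this.symm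
  · have hs0 : 0 < (n : ℝ) ^ (-β⁻¹) :=
      Real.rpow_pos_of_pos (by exact_mod_cast Nat.pos_of_ne_zero hn) _
    refine (hs (Real.exp (-(l * (n : ℝ) ^ (-β⁻¹))))
      ⟨(Real.exp_pos _).le, Real.exp_lt_one_iff.2 (by nlinarith)⟩).congr_fun fun k => ?_
    rw [← Real.exp_nat_mul]
    congr 2
    ring

theorem integrable_one_add_abs_mul_exp_neg_mul_abs_rpow {c p : ℝ} (hc : 0 < c) (hp : 0 < p) :
    Integrable fun ξ : ℝ => (1 + |ξ|) * Real.exp (-c * |ξ| ^ p) := by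
  have h0 := integrableOn_rpow_mul_exp_neg_mul_rpow (s := 0) (by norm_num) hp hc
  have h1 := integrableOn_rpow_mul_exp_neg_mul_rpow (s := 1) (by norm_num) hp hc
  have h : IntegrableOn (fun ξ : ℝ => (1 + |ξ|) * Real.exp (-c * |ξ| ^ p)) (Ioi 0) := by
    refine (h0.add h1).congr_fun (fun x (hx : 0 < x) => ?_) measurableSet_Ioi
    simp [abs_of_pos hx, add_mul]
  have h' : IntegrableOn (fun ξ : ℝ => (1 + |ξ|) * Real.exp (-c * |ξ| ^ p)) (Iic 0) := by
    rw [← integrableOn_Ici_iff_integrableOn_Ioi, ← neg_zero] at h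
    simpa using h.comp_neg_Iic
  rw [← integrableOn_univ, ← Iic_union_Ioi (a := (0 : ℝ))]
  exact h'.union h

theorem sq_rpow_eq_abs_rpow (β ξ : ℝ) : (ξ ^ 2) ^ β = |ξ| ^ (2 * β) := by
  rw [Real.rpow_mul (abs_nonneg ξ), Real.rpow_two, sq_abs]

theorem integrable_mul_exp_neg_mul_sq_of_abs_le {h : ℝ → ℝ} (hc : Continuous h)
    (hh : ∀ ξ, |h ξ| ≤ 1 + |ξ|) {t : ℝ} (ht : 0 < t) :
    Integrable fun ξ => h ξ * Real.exp (-t * ξ ^ 2) := by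
  refine (integrable_one_add_abs_mul_exp_neg_mul_abs_rpow ht two_pos).mono'
    (by fun_prop) (ae_of_all _ fun ξ => ?_)
  rw [Real.rpow_two, sq_abs, norm_mul, Real.norm_eq_abs, Real.norm_eq_abs, Real.abs_exp]
  exact mul_le_mul_of_nonneg_right (hh ξ) (Real.exp_pos _).le

theorem exists_pos_mul_le_of_continuousOn_Ioi {P : ℝ → ℝ} (hPpos : ∀ t, 0 < t → 0 < P t)
    (hPc : ContinuousOn P (Ioi 0)) {ε M : ℝ} (hε : 0 < ε) (hM : 0 < M) :
    ∃ η, 0 < η ∧ ∀ t, 0 < t →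
      η * (Real.exp (-t) - ε - 2 * Real.exp (-M * t)) ≤ P t := by
  obtain ⟨δ, hδ0, hδ⟩ : ∃ δ, 0 < δ ∧ ∀ t, t < δ → 1 ≤ 2 * Real.exp (-M * t) := by
    refine ⟨Real.log 2 / M, by positivity, fun t ht => ?_⟩
    have h1 : -Real.log 2 ≤ -M * t := by
      rw [lt_div_iff₀ hM] at ht
      linarith
    have h2 := Real.exp_le_exp.2 h1
    rw [Real.exp_neg, Real.exp_log two_pos] at h2
    linarith
  obtain ⟨T, hT⟩ : ∃ T, ∀ t, T < t → Real.exp (-t) ≤ ε := by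
    refine ⟨-Real.log ε, fun t ht => ?_⟩
    rw [← Real.le_log_iff_exp_le hε]
    linarith
  obtain ⟨s, hs, hmin⟩ := (isCompact_Icc (a := δ) (b := max δ T)).exists_isMinOn
    (nonempty_Icc.2 (le_max_left _ _)) (hPc.mono fun t ht => hδ0.trans_le ht.1)
  have hη : 0 < P s := hPpos s (hδ0.trans_le hs.1)
  refine ⟨P s, hη, fun t ht => ?_⟩
  have h1 : Real.exp (-t) ≤ 1 := Real.exp_le_one_iff.2 (by linarith)
  have h2 := Real.exp_pos (-M * t)
  have h3 := hPpos t ht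
  by_cases htδ : t < δ
  · nlinarith [hδ t htδ]
  by_cases htT : T < t
  · nlinarith [hT t htT]
  have h4 : P s ≤ P t := hmin ⟨not_lt.1 htδ, (not_lt.1 htT).trans (le_max_right _ _)⟩
  nlinarith

theorem mul_stableApprox_le_integral {β : ℝ} (hβ0 : 0 < β) (hβ1 : β ≤ 1) {n : ℕ} (hn : n ≠ 0)
    {h : ℝ → ℝ} {P : ℝ → ℝ} (hc : Continuous h) (hh : ∀ ξ, |h ξ| ≤ 1 + |ξ|)
    (hP : ∀ t, 0 < t → ∫ ξ, h ξ * Real.exp (-t * ξ ^ 2) = P t)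
    {ε M η : ℝ} (hε : 0 ≤ ε) (hM : 0 < M) (hη : 0 ≤ η)
    (hle : ∀ t, 0 < t → η * (Real.exp (-t) - ε - 2 * Real.exp (-M * t)) ≤ P t) :
    η * (stableApprox β n 1 - ε - 2 * stableApprox β n M) ≤
      ∫ ξ, h ξ * stableApprox β n (ξ ^ 2) := by
  obtain ⟨b, hb, hb0, hsum, htsum, hs⟩ := exists_hasSum_stableApprox hβ0 hβ1 hn
  set r : ℝ := (n : ℝ) ^ (-β⁻¹)
  have hr : 0 < r := Real.rpow_pos_of_pos (by exact_mod_cast Nat.pos_of_ne_zero hn) _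
  have hk : ∀ k : ℕ, k ≠ 0 → r ≤ k * r := fun k hk => by
    have : (1 : ℝ) ≤ k := by exact_mod_cast Nat.one_le_iff_ne_zero.2 hk
    nlinarith
  have hInt : ∀ k : ℕ, Integrable fun ξ => b k * (h ξ * Real.exp (-(k * r) * ξ ^ 2)) := by
    intro k
    rcases eq_or_ne k 0 with rfl | hk0
    · simp [hb0]
    · exact (integrable_mul_exp_neg_mul_sq_of_abs_le hc hh (hr.trans_le (hk k hk0))).const_mul _
  have hnorm : Summable fun k : ℕ => ∫ ξ, ‖b k * (h ξ * Real.exp (-(k * r) * ξ ^ 2))‖ := by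
    refine Summable.of_nonneg_of_le (fun k => integral_nonneg fun ξ => norm_nonneg _)
      (fun k => ?_) (hsum.mul_right (∫ ξ, ‖h ξ * Real.exp (-r * ξ ^ 2)‖))
    rcases eq_or_ne k 0 with rfl | hk0
    · simp [hb0]
    · rw [← integral_const_mul]
      refine integral_mono (hInt k).norm
        ((integrable_mul_exp_neg_mul_sq_of_abs_le hc hh hr).norm.const_mul _) fun ξ => ?_
      simp only [norm_mul, Real.norm_eq_abs, Real.abs_exp, abs_of_nonneg (hb k)]
      have := hk k hk0
      have := hb k
      gcongr
  have hS := hasSum_integral_of_summable_integral_norm hInt hnorm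
  have heq : ∫ ξ, ∑' k : ℕ, b k * (h ξ * Real.exp (-(k * r) * ξ ^ 2)) =
      ∫ ξ, h ξ * stableApprox β n (ξ ^ 2) := by
    refine integral_congr_ae ?_
    filter_upwards [compl_mem_ae_iff.2 (measure_singleton (0 : ℝ))] with ξ hξ
    refine (((hs (ξ ^ 2) (sq_pos_of_ne_zero hξ)).mul_left (h ξ)).congr_fun
      fun k => ?_).tsum_eq
    ring
  rw [heq] at hS
  have h1 := hs 1 one_pos
  have hR := ((h1.sub (hsum.hasSum.mul_left ε)).sub ((hs M hM).mul_left 2)).mul_left η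
  refine le_trans ?_ (hasSum_le (fun k => ?_) hR hS)
  · have : ε * ∑' k, b k ≤ ε := by nlinarith
    gcongr
  · rw [integral_const_mul]
    rcases eq_or_ne k 0 with rfl | hk0
    · simp [hb0]
    · rw [hP _ (hr.trans_le (hk k hk0))]
      refine le_trans (le_of_eq ?_)
        (mul_le_mul_of_nonneg_left (hle _ (hr.trans_le (hk k hk0))) (hb k))
      rw [mul_one, show -M * (k * r) = -(k * r) * M by ring]
      ring

/-- Pairing `h` with Gaussians of every scale positively forces a positive pairing with
`exp (-|ξ| ^ (2 * β))`, which is a mixture of such Gaussians. -/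
theorem integral_mul_exp_neg_abs_rpow_pos {β : ℝ} (hβ0 : 0 < β) (hβ1 : β ≤ 1) {h : ℝ → ℝ}
    {P : ℝ → ℝ} (hc : Continuous h) (hh : ∀ ξ, |h ξ| ≤ 1 + |ξ|)
    (hP : ∀ t, 0 < t → ∫ ξ, h ξ * Real.exp (-t * ξ ^ 2) = P t)
    (hPpos : ∀ t, 0 < t → 0 < P t) (hPc : ContinuousOn P (Ioi 0)) :
    0 < ∫ ξ, h ξ * Real.exp (-(|ξ| ^ (2 * β))) := by
  set ε : ℝ := Real.exp (-1) / 4 with hε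
  have hε0 : 0 < ε := by positivity
  obtain ⟨M, hM0, hM⟩ : ∃ M : ℝ, 0 < M ∧ 2 * Real.exp (-(M ^ β)) < ε := by
    have h1 : Tendsto (fun M : ℝ => 2 * Real.exp (-(M ^ β))) atTop (𝓝 (2 * 0)) :=
      (Real.tendsto_exp_neg_atTop_nhds_zero.comp (tendsto_rpow_atTop hβ0)).const_mul 2
    rw [mul_zero] at h1
    exact ((eventually_gt_atTop 0).and (h1.eventually (gt_mem_nhds hε0))).exists
  obtain ⟨η, hη, hle⟩ := exists_pos_mul_le_of_continuousOn_Ioi hPpos hPc hε0 hM0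
  have hlim : Tendsto (fun n : ℕ => ∫ ξ, h ξ * stableApprox β (n + 1) (ξ ^ 2)) atTop
      (𝓝 (∫ ξ, h ξ * Real.exp (-(|ξ| ^ (2 * β))))) := by
    refine tendsto_integral_of_dominated_convergence _ (fun n => ?_)
      (integrable_one_add_abs_mul_exp_neg_mul_abs_rpow (c := 1 / 2) (p := 2 * β)
        (by norm_num) (by positivity)) (fun n => ae_of_all _ fun ξ => ?_) ?_
    · refine (hc.measurable.mul ?_).aestronglyMeasurable
      unfold stableApprox
      fun_prop
    · have h1 := stableApprox_le hβ0 hβ1 n.succ_ne_zero (sq_nonneg ξ)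
      have h2 := stableApprox_nonneg hβ0.le (n + 1) (sq_nonneg ξ)
      rw [sq_rpow_eq_abs_rpow] at h1
      rw [norm_mul, Real.norm_eq_abs, Real.norm_eq_abs, abs_of_nonneg h2]
      refine mul_le_mul (hh ξ) (h1.trans_eq ?_) h2 (by positivity)
      congr 1
      ring
    · filter_upwards [compl_mem_ae_iff.2 (measure_singleton (0 : ℝ))] with ξ hξ
      have := (tendsto_stableApprox hβ0 (sq_pos_of_ne_zero hξ : 0 < ξ ^ 2)).comp
        (tendsto_add_atTop_nat 1)
      rw [sq_rpow_eq_abs_rpow] at this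
      exact this.const_mul _
  have hlow : Tendsto (fun n : ℕ => η * (stableApprox β (n + 1) 1 - ε -
      2 * stableApprox β (n + 1) M)) atTop
      (𝓝 (η * (Real.exp (-(1 ^ β)) - ε - 2 * Real.exp (-(M ^ β))))) :=
    ((((tendsto_stableApprox hβ0 one_pos).comp (tendsto_add_atTop_nat 1)).sub_const ε).sub
      (((tendsto_stableApprox hβ0 hM0).comp (tendsto_add_atTop_nat 1)).const_mul 2)).const_mul η
  refine lt_of_lt_of_le ?_ (le_of_tendsto_of_tendsto' hlow hlim fun n =>
    mul_stableApprox_le_integral hβ0 hβ1 n.succ_ne_zero hc hh hP hε0.le hM0 hη.le hle)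
  rw [Real.one_rpow]
  have : 0 < Real.exp (-1) := Real.exp_pos _
  exact mul_pos hη (by linarith)

theorem integral_cos_mul_exp_neg_mul_sq {t : ℝ} (ht : 0 < t) (x : ℝ) :
    ∫ ξ, Real.cos (x * ξ) * Real.exp (-t * ξ ^ 2) = √(π / t) * Real.exp (-x ^ 2 / (4 * t)) := by
  have h := congrArg Complex.re (fourierIntegral_gaussian (b := t) (by simpa using ht) x)
  have hi : Integrable fun ξ : ℝ => cexp (I * x * ξ) * cexp (-t * ξ ^ 2) := by
    refine (integrable_exp_neg_mul_sq ht).mono' (by fun_prop) (ae_of_all _ fun ξ => ?_)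
    rw [norm_mul, norm_exp, norm_exp]
    norm_cast
    simp
  have hr : (((π : ℂ) / t) ^ (1 / 2 : ℂ) * cexp (-x ^ 2 / (4 * t))) =
      ((√(π / t) * Real.exp (-x ^ 2 / (4 * t)) : ℝ) : ℂ) := by
    rw [Real.sqrt_eq_rpow, ofReal_mul, ofReal_cpow (by positivity)]
    push_cast
    rfl
  rw [hr, ofReal_re] at h
  rw [← h]
  rw [← RCLike.re_eq_complex_re, ← integral_re hi]
  congr 1 with ξ
  have : cexp (-t * ξ ^ 2) = (Real.exp (-t * ξ ^ 2) : ℝ) := by push_cast; rfl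
  rw [this]
  change _ = Complex.re _
  rw [re_mul_ofReal, exp_re]
  simp

theorem hasDerivAt_integral_cos_mul {w : ℝ → ℝ} (hw : Integrable w)
    (hw' : Integrable fun ξ => ξ * w ξ) (x : ℝ) :
    HasDerivAt (fun x => ∫ ξ, Real.cos (x * ξ) * w ξ)
      (-∫ ξ, ξ * Real.sin (x * ξ) * w ξ) x := by
  have hm := hw.aestronglyMeasurable
  have h := (hasDerivAt_integral_of_dominated_loc_of_deriv_le (μ := volume) (s := univ) (x₀ := x)
    (F := fun x ξ => Real.cos (x * ξ) * w ξ) (F' := fun x ξ => -(ξ * Real.sin (x * ξ) * w ξ))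
    (bound := fun ξ => ‖ξ * w ξ‖) univ_mem
    (Eventually.of_forall fun y =>
      (Continuous.aestronglyMeasurable (by fun_prop)).mul hm)
    (hw.norm.mono' ((Continuous.aestronglyMeasurable (by fun_prop)).mul hm)
      (ae_of_all _ fun ξ => ?_))
    ((Continuous.aestronglyMeasurable (by fun_prop)).mul hm).neg
    (ae_of_all _ fun ξ y _ => ?_) hw'.norm (ae_of_all _ fun ξ y _ => ?_)).2
  · rwa [integral_neg] at h
  · rw [norm_mul]
    exact mul_le_of_le_one_left (norm_nonneg _) (Real.abs_cos_le_one _)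
  · rw [norm_neg, mul_right_comm, norm_mul]
    exact mul_le_of_le_one_right (norm_nonneg _) (Real.abs_sin_le_one _)
  · exact ((hasDerivAt_mul_const ξ).cos.mul_const (w ξ)).congr_deriv (by ring)

theorem integral_mul_sin_mul_exp_neg_mul_sq {t : ℝ} (ht : 0 < t) (x : ℝ) :
    ∫ ξ, ξ * Real.sin (x * ξ) * Real.exp (-t * ξ ^ 2) =
      √(π / t) * (x / (2 * t)) * Real.exp (-x ^ 2 / (4 * t)) := by
  have h1 := hasDerivAt_integral_cos_mul (integrable_exp_neg_mul_sq ht)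
    (integrable_mul_exp_neg_mul_sq ht) x
  simp only [integral_cos_mul_exp_neg_mul_sq ht] at h1
  have h2 : HasDerivAt (fun x : ℝ => √(π / t) * Real.exp (-x ^ 2 / (4 * t)))
      (√(π / t) * (Real.exp (-x ^ 2 / (4 * t)) * (-(2 * x) / (4 * t)))) x := by
    have := (((hasDerivAt_pow 2 x).neg.div_const (4 * t)).exp).const_mul √(π / t)
    simpa using this
  rw [← neg_inj, h1.unique h2]
  field_simp
  ring

theorem FTinv_ofReal_of_even {w : ℝ → ℝ} (hw : Integrable w) (he : ∀ ξ, w (-ξ) = w ξ) (x : ℝ) :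
    FTinv (fun ξ => (w ξ : ℂ)) x = (((2 * π)⁻¹ * ∫ ξ, Real.cos (x * ξ) * w ξ : ℝ) : ℂ) := by
  have hm := hw.aestronglyMeasurable
  have hcos : Integrable fun ξ => Real.cos (x * ξ) * w ξ :=
    hw.norm.mono' ((Continuous.aestronglyMeasurable (by fun_prop)).mul hm)
      (ae_of_all _ fun ξ => by
        rw [norm_mul]
        exact mul_le_of_le_one_left (norm_nonneg _) (Real.abs_cos_le_one _))
  have hsin : Integrable fun ξ => Real.sin (x * ξ) * w ξ :=
    hw.norm.mono' ((Continuous.aestronglyMeasurable (by fun_prop)).mul hm)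
      (ae_of_all _ fun ξ => by
        rw [norm_mul]
        exact mul_le_of_le_one_left (norm_nonneg _) (Real.abs_sin_le_one _))
  have hodd : ∫ ξ, Real.sin (x * ξ) * w ξ = 0 := by
    have := integral_neg_eq_self (fun ξ => Real.sin (x * ξ) * w ξ) volume
    simp only [he, mul_neg, Real.sin_neg, neg_mul, integral_neg] at this
    linarith
  have hsplit : ∀ ξ : ℝ, cexp (I * x * ξ) * (w ξ : ℂ) =
      ((Real.cos (x * ξ) * w ξ : ℝ) : ℂ) + ((Real.sin (x * ξ) * w ξ : ℝ) : ℂ) * I := by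
    intro ξ
    rw [show I * x * ξ = ((x * ξ : ℝ) : ℂ) * I by push_cast; ring, exp_mul_I]
    push_cast
    ring
  have hInt : ∫ ξ : ℝ, cexp (I * x * ξ) * (w ξ : ℂ) =
      ((∫ ξ, Real.cos (x * ξ) * w ξ : ℝ) : ℂ) := by
    simp only [hsplit]
    have hcos' : Integrable fun ξ => ((Real.cos (x * ξ) * w ξ : ℝ) : ℂ) := hcos.ofReal
    have hsin' : Integrable fun ξ => ((Real.sin (x * ξ) * w ξ : ℝ) : ℂ) := hsin.ofReal
    rw [integral_add hcos' (hsin'.mul_const I), integral_mul_const, integral_complex_ofReal,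
      integral_complex_ofReal, hodd]
    simp
  rw [FTinv, hInt, real_smul, ← ofReal_mul]

theorem integral_cos_mul_exp_neg_abs_rpow_pos {β : ℝ} (hβ0 : 0 < β) (hβ1 : β ≤ 1) (x : ℝ) :
    0 < ∫ ξ, Real.cos (x * ξ) * Real.exp (-(|ξ| ^ (2 * β))) := by
  refine integral_mul_exp_neg_abs_rpow_pos hβ0 hβ1 (by fun_prop) (fun ξ => ?_)
    (fun t ht => integral_cos_mul_exp_neg_mul_sq ht x) (fun t ht => by positivity) ?_
  · linarith [Real.abs_cos_le_one (x * ξ), abs_nonneg ξ]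
  · refine fun t (ht : 0 < t) => ContinuousAt.continuousWithinAt ?_
    have := ht.ne'
    fun_prop (disch := positivity)

theorem integral_mul_sin_mul_exp_neg_abs_rpow_pos {β : ℝ} (hβ0 : 0 < β) (hβ1 : β ≤ 1) {x : ℝ}
    (hx : 0 < x) : 0 < ∫ ξ, ξ * Real.sin (x * ξ) * Real.exp (-(|ξ| ^ (2 * β))) := by
  refine integral_mul_exp_neg_abs_rpow_pos hβ0 hβ1 (by fun_prop) (fun ξ => ?_)
    (fun t ht => integral_mul_sin_mul_exp_neg_mul_sq ht x) (fun t ht => by positivity) ?_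
  · rw [abs_mul]
    have := mul_le_of_le_one_right (abs_nonneg ξ) (Real.abs_sin_le_one (x * ξ))
    linarith
  · refine fun t (ht : 0 < t) => ContinuousAt.continuousWithinAt ?_
    have := ht.ne'
    fun_prop (disch := positivity)

end

/-- the function `K` with Fourier transform `e^{-|ξ|^α}` (here realized as the
inverse Fourier transform of `ξ ↦ e^{-|ξ|^α}`) is real-valued, even, strictly positive,
and strictly decreasing on `(0,∞)`. -/
theorem stmt_15 (α : ℝ) (hα1 : 1 ≤ α) (hα2 : α ≤ 2) :
    (∀ x : ℝ, (FTinv (fun ξ => ((Real.exp (-(|ξ| ^ α)) : ℝ) : ℂ)) x).im = 0) ∧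
    (∀ x : ℝ, FTinv (fun ξ => ((Real.exp (-(|ξ| ^ α)) : ℝ) : ℂ)) (-x)
      = FTinv (fun ξ => ((Real.exp (-(|ξ| ^ α)) : ℝ) : ℂ)) x) ∧
    (∀ x : ℝ, 0 < (FTinv (fun ξ => ((Real.exp (-(|ξ| ^ α)) : ℝ) : ℂ)) x).re) ∧
    (∀ x : ℝ, 0 < x →
      deriv (fun y : ℝ => (FTinv (fun ξ => ((Real.exp (-(|ξ| ^ α)) : ℝ) : ℂ)) y).re) x < 0) := by
  obtain ⟨β, rfl⟩ : ∃ β, α = 2 * β := ⟨α / 2, by ring⟩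
  have hβ0 : 0 < β := by linarith
  have hβ1 : β ≤ 1 := by linarith
  have hb : Integrable fun ξ : ℝ => (1 + |ξ|) * Real.exp (-(|ξ| ^ (2 * β))) := by
    simpa using integrable_one_add_abs_mul_exp_neg_mul_abs_rpow one_pos
      (show 0 < 2 * β by positivity)
  have hw : Integrable fun ξ : ℝ => Real.exp (-(|ξ| ^ (2 * β))) := by
    refine hb.mono' (by fun_prop (disch := positivity)) (ae_of_all _ fun ξ => ?_)
    rw [Real.norm_eq_abs, Real.abs_exp]
    exact le_mul_of_one_le_left (Real.exp_pos _).le (by linarith [abs_nonneg ξ])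
  have hw' : Integrable fun ξ : ℝ => ξ * Real.exp (-(|ξ| ^ (2 * β))) := by
    refine hb.mono' (by fun_prop (disch := positivity)) (ae_of_all _ fun ξ => ?_)
    rw [norm_mul, Real.norm_eq_abs, Real.norm_eq_abs, Real.abs_exp]
    exact mul_le_mul_of_nonneg_right (by linarith) (Real.exp_pos _).le
  have hK := FTinv_ofReal_of_even hw fun ξ => by rw [abs_neg]
  simp only [hK, Complex.ofReal_im, Complex.ofReal_re, neg_mul, Real.cos_neg, implies_true,
    true_and]
  have hpi : 0 < (2 * Real.pi)⁻¹ := by positivity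
  refine ⟨fun x => mul_pos hpi (integral_cos_mul_exp_neg_abs_rpow_pos hβ0 hβ1 x),
    fun x hx => ?_⟩
  rw [((hasDerivAt_integral_cos_mul hw hw' x).const_mul _).deriv]
  exact mul_neg_of_pos_of_neg hpi
    (neg_neg_of_pos (integral_mul_sin_mul_exp_neg_abs_rpow_pos hβ0 hβ1 hx))
end
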